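/- For an extremal odd unimodular lattice L in dimension 36 (minimum norm 4), the number α of norm-1 vectors in the shadow S(L) satisfies 0 ≤ α ≤ 16, and the kissing number of L equals 42840 + 4096α. -/

import Mathlib

/-- The dual of a set of vectors in `ℝⁿ`. -/
def dualLattice {n : ℕ} (L : Set (Fin n → ℝ)) : Set (Fin n → ℝ) :=
  {v | ∀ w ∈ L, ∃ m : ℤ, ∑ i, v i * w i = (m : ℝ)}

/-- The even sublattice (even-norm part) of a set of vectors. -/
def evenPart {n : ℕ} (L : Set (Fin n → ℝ)) : Set (Fin n → ℝ) :=
  {x ∈ L | ∃ m : ℤ, ∑ i, x i * x i = ((2 * m : ℤ) : ℝ)}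

/-- The shadow `S(L) = (L₀)* \ L` of an odd unimodular lattice. -/
def shadow {n : ℕ} (L : Set (Fin n → ℝ)) : Set (Fin n → ℝ) :=
  dualLattice (evenPart L) \ L

section PoissonSummation

open MeasureTheory Set

variable {ι : Type*} [Fintype ι]

theorem integral_eq_tsum_integral_unitCube {f : (ι → ℝ) → ℂ} (hf : Integrable f) :
    ∫ x, f x = ∑' m : ι → ℤ, ∫ x in {x : ι → ℝ | ∀ i, x i ∈ Ioc (0 : ℝ) (0 + 1)},
      f (x + fun i => (m i : ℝ)) := by
  classical
  have hcube : (ZSpan.fundamentalDomain (Pi.basisFun ℝ ι)) =ᵐ[volume]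
      {x : ι → ℝ | ∀ i, x i ∈ Ioc (0 : ℝ) (0 + 1)} := by
    have h1 := Measure.univ_pi_Ioc_ae_eq_Icc (μ := fun _ : ι => (volume : Measure ℝ))
      (f := fun _ => 0) (g := fun _ => 1)
    have h2 := Measure.univ_pi_Ico_ae_eq_Icc (μ := fun _ : ι => (volume : Measure ℝ))
      (f := fun _ => 0) (g := fun _ => 1)
    have h3 : {x : ι → ℝ | ∀ i, x i ∈ Ioc (0 : ℝ) (0 + 1)} =
        Set.univ.pi fun _ => Ioc (0 : ℝ) 1 := by
      ext x; simp
    rw [ZSpan.fundamentalDomain_pi_basisFun, h3]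
    exact h2.trans h1.symm
  have hfd := ZSpan.isAddFundamentalDomain (Pi.basisFun ℝ ι) volume
  let b := (Pi.basisFun ℝ ι).restrictScalars ℤ
  have hb : ∀ m : ι → ℤ, ((b.equivFun.symm m : _) : ι → ℝ) = fun i => (m i : ℝ) := by
    intro m
    ext i
    simp [b, Module.Basis.equivFun_symm_apply, Finset.sum_apply, Pi.single_apply]
  have : VAddInvariantMeasure (Submodule.span ℤ (range (Pi.basisFun ℝ ι))) (ι → ℝ) volume :=
    inferInstanceAs <| VAddInvariantMeasure
      (Submodule.span ℤ (range (Pi.basisFun ℝ ι))).toAddSubgroup (ι → ℝ) volume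
  have : MeasurableConstVAdd (Submodule.span ℤ (range (Pi.basisFun ℝ ι))) (ι → ℝ) :=
    inferInstanceAs <| MeasurableConstVAdd
      (Submodule.span ℤ (range (Pi.basisFun ℝ ι))).toAddSubgroup (ι → ℝ)
  have : Countable (Submodule.span ℤ (range (Pi.basisFun ℝ ι))) :=
    b.equivFun.toEquiv.countable_iff.mpr inferInstance
  rw [hfd.integral_eq_tsum'' f hf, ← b.equivFun.symm.toEquiv.tsum_eq]
  refine tsum_congr fun m => ?_
  rw [setIntegral_congr_set hcube]
  refine integral_congr_ae (.of_forall fun x => ?_)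
  change f (((b.equivFun.symm m : _) : ι → ℝ) + x) = _
  rw [hb, add_comm]

theorem mFourier_coe_apply (k : ι → ℤ) (x : ι → ℝ) :
    UnitAddTorus.mFourier k (fun i => (x i : UnitAddCircle)) =
      Complex.exp (2 * Real.pi * Complex.I * ∑ i, (k i : ℂ) * x i) := by
  simp only [UnitAddTorus.mFourier, ContinuousMap.coe_mk, fourier_coe_apply, ← Complex.exp_sum,
    Finset.mul_sum]
  congr 1
  refine Finset.sum_congr rfl fun i _ => ?_
  push_cast
  ring

/-- Poisson summation on `ℤⁿ`. -/
theorem hasSum_poisson_pi {g : (ι → ℝ) → ℂ} (hc : Continuous g) (hi : Integrable g)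
    (hb : ∀ R : ℝ, ∃ u : (ι → ℤ) → ℝ, Summable u ∧
      ∀ x : ι → ℝ, ‖x‖ ≤ R → ∀ m : ι → ℤ, ‖g (x + fun i => (m i : ℝ))‖ ≤ u m)
    (hs : Summable fun k : ι → ℤ =>
      ∫ v, Complex.exp (2 * Real.pi * Complex.I * ∑ i, ((-k) i : ℂ) * v i) * g v)
    (x : ι → ℝ) :
    HasSum (fun k : ι → ℤ =>
      (∫ v, Complex.exp (2 * Real.pi * Complex.I * ∑ i, ((-k) i : ℂ) * v i) * g v) *
        Complex.exp (2 * Real.pi * Complex.I * ∑ i, (k i : ℂ) * x i))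
      (∑' m : ι → ℤ, g (x + fun i => (m i : ℝ))) := by
  classical
  let G : C(ι → ℝ, ℂ) := ⟨fun x => ∑' m : ι → ℤ, g (x + fun i => (m i : ℝ)), by
    refine continuous_iff_continuousAt.mpr fun x => ?_
    obtain ⟨u, hu, hu'⟩ := hb (‖x‖ + 1)
    have : ContinuousOn (fun x => ∑' m : ι → ℤ, g (x + fun i => (m i : ℝ)))
        (Metric.closedBall 0 (‖x‖ + 1)) :=
      continuousOn_tsum (fun m => (by fun_prop)) hu
        (fun m y hy => hu' y (by simpa using hy) m)
    refine this.continuousAt (Metric.closedBall_mem_nhds_of_mem ?_)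
    simp⟩
  let q : C(ι → ℝ, UnitAddTorus ι) := ⟨fun x i => (x i : UnitAddCircle), by
    refine continuous_pi fun i => ?_
    exact (AddCircle.continuous_mk' 1).comp (continuous_apply i)⟩
  have hq : Topology.IsQuotientMap q :=
    (IsOpenQuotientMap.piMap (f := fun (_ : ι) (x : ℝ) => (x : UnitAddCircle))
      (fun _ => QuotientAddGroup.isOpenQuotientMap_mk)).isQuotientMap
  have hfac : Function.FactorsThrough G q := by
    intro a b hab
    have : ∀ i, ∃ n : ℤ, a i - b i = n := by
      intro i
      have h : ((a i - b i : ℝ) : UnitAddCircle) = 0 := by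
        rw [AddCircle.coe_sub, sub_eq_zero]
        exact congrFun hab i
      obtain ⟨n, hn⟩ := (AddCircle.coe_eq_zero_iff (1 : ℝ)).mp h
      exact ⟨n, by simpa using hn.symm⟩
    choose n hn using this
    change ∑' m : ι → ℤ, g (a + fun i => (m i : ℝ)) = ∑' m : ι → ℤ, g (b + fun i => (m i : ℝ))
    rw [← (Equiv.addRight n).tsum_eq (fun m : ι → ℤ => g (b + fun i => (m i : ℝ)))]
    refine tsum_congr fun m => congrArg g ?_
    ext i
    have := hn i
    simp only [Pi.add_apply, Equiv.coe_addRight, Int.cast_add]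
    linarith
  let F := hq.lift G hfac
  have hF : ∀ x : ι → ℝ, F (fun i => (x i : UnitAddCircle)) =
      ∑' m : ι → ℤ, g (x + fun i => (m i : ℝ)) := fun x =>
    DFunLike.congr_fun (hq.lift_comp G hfac) x
  have hcoeff : ∀ k : ι → ℤ, UnitAddTorus.mFourierCoeff F k =
      ∫ v, Complex.exp (2 * Real.pi * Complex.I * ∑ i, ((-k) i : ℂ) * v i) * g v := by
    intro k
    have hnorm : ∀ v : ι → ℝ,
        ‖Complex.exp (2 * Real.pi * Complex.I * ∑ i, ((-k) i : ℂ) * v i)‖ = 1 := by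
      intro v
      rw [show (2 * Real.pi * Complex.I * ∑ i, ((-k) i : ℂ) * v i) =
        ((2 * Real.pi * ∑ i, ((-k) i : ℝ) * v i : ℝ) : ℂ) * Complex.I by push_cast; ring]
      exact Complex.norm_exp_ofReal_mul_I _
    have hint : Integrable fun v =>
        Complex.exp (2 * Real.pi * Complex.I * ∑ i, ((-k) i : ℂ) * v i) * g v := by
      refine hi.bdd_mul (c := 1) ?_ (.of_forall fun v => (hnorm v).le)
      exact Continuous.aestronglyMeasurable (by fun_prop)
    have hper : ∀ (v : ι → ℝ) (m : ι → ℤ),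
        Complex.exp (2 * Real.pi * Complex.I * ∑ i, ((-k) i : ℂ) * ((v + fun i => (m i : ℝ)) i : ℝ))
        = Complex.exp (2 * Real.pi * Complex.I * ∑ i, ((-k) i : ℂ) * v i) := by
      intro v m
      rw [Complex.exp_eq_exp_iff_exists_int]
      refine ⟨∑ i, (-k) i * m i, ?_⟩
      push_cast
      simp only [Pi.add_apply, Complex.ofReal_add, mul_add, Finset.sum_add_distrib]
      push_cast
      ring
    rw [integral_eq_tsum_integral_unitCube hint, UnitAddTorus.mFourierCoeff_eq_integral _ _ 0]
    simp only [hF, hper, mFourier_coe_apply, smul_eq_mul, Pi.zero_apply]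
    obtain ⟨u, hu, hu'⟩ := hb 1
    have hcube : MeasurableSet {x : ι → ℝ | ∀ i, x i ∈ Ioc (0 : ℝ) (0 + 1)} := by
      have h3 : {x : ι → ℝ | ∀ i, x i ∈ Ioc (0 : ℝ) (0 + 1)} =
        Set.univ.pi fun _ => Ioc (0 : ℝ) 1 := by ext x; simp
      rw [h3]
      exact MeasurableSet.univ_pi fun _ => measurableSet_Ioc
    have hvol : volume {x : ι → ℝ | ∀ i, x i ∈ Ioc (0 : ℝ) (0 + 1)} = 1 := by
      have h3 : {x : ι → ℝ | ∀ i, x i ∈ Ioc (0 : ℝ) (0 + 1)} =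
        Set.univ.pi fun _ => Ioc (0 : ℝ) 1 := by ext x; simp
      rw [h3, volume_pi_pi]
      simp
    have hle : ∀ v ∈ {x : ι → ℝ | ∀ i, x i ∈ Ioc (0 : ℝ) (0 + 1)}, ‖v‖ ≤ 1 := by
      intro v hv
      refine (pi_norm_le_iff_of_nonneg zero_le_one).mpr fun i => ?_
      have := hv i
      rw [Real.norm_of_nonneg this.1.le]
      linarith [this.2]
    have hints : ∀ m : ι → ℤ, IntegrableOn (fun v =>
        Complex.exp (2 * Real.pi * Complex.I * ∑ i, ((-k) i : ℂ) * v i) *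
          g (v + fun i => (m i : ℝ))) {x : ι → ℝ | ∀ i, x i ∈ Ioc (0 : ℝ) (0 + 1)} := by
      intro m
      have := (hint.comp_add_right (fun i => (m i : ℝ))).integrableOn
        (s := {x : ι → ℝ | ∀ i, x i ∈ Ioc (0 : ℝ) (0 + 1)})
      simpa only [hper] using this
    simp_rw [← tsum_mul_left]
    refine ((hasSum_integral_of_summable_integral_norm hints ?_).tsum_eq).symm
    refine Summable.of_nonneg_of_le (fun m => integral_nonneg fun _ => norm_nonneg _)
      (fun m => ?_) hu
    refine (setIntegral_mono_on (hints m).norm (integrableOn_const (C := u m) (by rw [hvol]; simp))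
      hcube fun v hv => ?_).trans
      (by rw [setIntegral_const, measureReal_def, hvol]; simp)
    rw [norm_mul, hnorm, one_mul]
    exact hu' v (hle v hv) m
  have := UnitAddTorus.hasSum_mFourier_series_apply_of_summable (f := F)
    ((summable_congr hcoeff).mpr hs) (fun i => (x i : UnitAddCircle))
  simpa only [hcoeff, hF, mFourier_coe_apply, smul_eq_mul] using this

end PoissonSummation

section GaussianPoisson

open MeasureTheory Matrix

variable {ι : Type*} [Fintype ι] [DecidableEq ι]

theorem measurableEmbedding_toLin' {M : Matrix ι ι ℝ} (hM : M.det ≠ 0) :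
    MeasurableEmbedding (Matrix.toLin' M) :=
  (LinearMap.continuous_of_finiteDimensional _).measurableEmbedding
    (Matrix.mulVec_injective_of_isUnit ((Matrix.isUnit_iff_isUnit_det M).mpr hM.isUnit))

theorem integral_comp_mulVec {M : Matrix ι ι ℝ} (hM : M.det ≠ 0) (f : (ι → ℝ) → ℂ) :
    ∫ v, f (M *ᵥ v) = (|M.det⁻¹| : ℝ) * ∫ u, f u := by
  have h := (measurableEmbedding_toLin' hM).integral_map (μ := volume) f
  rw [Real.map_matrix_volume_pi_eq_smul_volume_pi hM, integral_smul_measure] at h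
  simp only [Matrix.toLin'_apply] at h
  rw [← h, ENNReal.toReal_ofReal (abs_nonneg _), Complex.real_smul]

omit [DecidableEq ι] in
theorem norm_cexp_neg_mul_sum (b : ℂ) (w : ι → ℝ) :
    ‖Complex.exp (-b * ∑ i, (w i : ℂ) ^ 2)‖ = Real.exp (-b.re * ∑ i, w i ^ 2) := by
  rw [Complex.norm_exp]
  congr 1
  rw [show (-b * ∑ i, (w i : ℂ) ^ 2) = -b * ((∑ i, w i ^ 2 : ℝ) : ℂ) by push_cast; rfl,
    Complex.re_mul_ofReal, Complex.neg_re]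

/-- Poisson summation for a Gaussian on the lattice `M ℤⁿ`, whose dual lattice is `M⁻ᵀ ℤⁿ`. -/
theorem hasSum_gaussian_poisson {M : Matrix ι ι ℝ} (hM : M.det ≠ 0)
    (hs : ∀ c : ℝ, 0 < c → Summable fun m : ι → ℤ =>
      Real.exp (-c * ∑ i, (M *ᵥ fun j => (m j : ℝ)) i ^ 2))
    (hs' : ∀ c : ℝ, 0 < c → Summable fun m : ι → ℤ =>
      Real.exp (-c * ∑ i, (M⁻¹ᵀ *ᵥ fun j => (m j : ℝ)) i ^ 2))
    {b : ℂ} (hb : 0 < b.re) (v : ι → ℝ) :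
    HasSum (fun k : ι → ℤ => (|M.det⁻¹| : ℝ) * (Real.pi / b) ^ (Fintype.card ι / 2 : ℂ) *
        Complex.exp (-(Real.pi ^ 2 / b) * ∑ i, ((M⁻¹ᵀ *ᵥ fun j => (k j : ℝ)) i : ℂ) ^ 2) *
        Complex.exp (2 * Real.pi * Complex.I *
          ∑ i, ((M⁻¹ᵀ *ᵥ fun j => (k j : ℝ)) i : ℂ) * v i))
      (∑' m : ι → ℤ, Complex.exp (-b * ∑ i, ((((M *ᵥ fun j => (m j : ℝ)) + v) i : ℝ) : ℂ) ^ 2)) := by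
  have hu : IsUnit M.det := hM.isUnit
  let g : (ι → ℝ) → ℂ := fun x => Complex.exp (-b * ∑ i, ((M *ᵥ x) i : ℂ) ^ 2)
  have hMc : Continuous fun x : ι → ℝ => M *ᵥ x := by fun_prop
  have hgc : Continuous g := by fun_prop
  have hi : Integrable fun u : ι → ℝ => Complex.exp (-b * ∑ i, (u i : ℂ) ^ 2) := by
    simpa using GaussianFourier.integrable_cexp_neg_mul_sum_add hb (fun _ : ι => 0)
  have hgi : Integrable g := by
    have h := (measurableEmbedding_toLin' hM).integrable_map_iff (μ := volume)
      (g := fun u : ι → ℝ => Complex.exp (-b * ∑ i, (u i : ℂ) ^ 2))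
    rw [Real.map_matrix_volume_pi_eq_smul_volume_pi hM] at h
    exact h.mp (hi.smul_measure ENNReal.ofReal_ne_top)
  have hcoeff : ∀ k : ι → ℤ,
      ∫ w, Complex.exp (2 * Real.pi * Complex.I * ∑ i, ((-k) i : ℂ) * w i) * g w =
      (|M.det⁻¹| : ℝ) * ((Real.pi / b) ^ (Fintype.card ι / 2 : ℂ) *
        Complex.exp (-(Real.pi ^ 2 / b) *
          ∑ i, ((M⁻¹ᵀ *ᵥ fun j => (k j : ℝ)) i : ℂ) ^ 2)) := by
    intro k
    set n : ι → ℝ := M⁻¹ᵀ *ᵥ fun j => (k j : ℝ) with hn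
    have hdot : ∀ w : ι → ℝ, ∑ i, (k i : ℝ) * w i = ∑ i, n i * (M *ᵥ w) i := by
      intro w
      change (fun j => (k j : ℝ)) ⬝ᵥ w = n ⬝ᵥ (M *ᵥ w)
      rw [hn, Matrix.mulVec_transpose, ← Matrix.dotProduct_mulVec, Matrix.mulVec_mulVec,
        Matrix.nonsing_inv_mul _ hu, Matrix.one_mulVec]
    have h1 : ∀ w : ι → ℝ,
        Complex.exp (2 * Real.pi * Complex.I * ∑ i, ((-k) i : ℂ) * w i) * g w =
        (fun u : ι → ℝ => Complex.exp (-b * ∑ i, (u i : ℂ) ^ 2 +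
          ∑ i, (-2 * Real.pi * Complex.I * n i) * (u i : ℂ))) (M *ᵥ w) := by
      intro w
      have h2 : ∑ i, ((-k) i : ℂ) * w i = -((∑ i, n i * (M *ᵥ w) i : ℝ) : ℂ) := by
        rw [← hdot]
        push_cast
        simp
      simp only [g]
      rw [← Complex.exp_add, h2]
      congr 1
      push_cast
      simp only [mul_assoc, ← Finset.mul_sum]
      ring
    rw [(integral_congr_ae (.of_forall h1)).trans (integral_comp_mulVec hM (fun u : ι → ℝ =>
      Complex.exp (-b * ∑ i, (u i : ℂ) ^ 2 +
          ∑ i, (-2 * Real.pi * Complex.I * n i) * (u i : ℂ)))),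
      GaussianFourier.integral_cexp_neg_mul_sum_add hb]
    congr 3
    have hb0 : b ≠ 0 := by rintro rfl; simp at hb
    simp only [mul_pow, ← Finset.mul_sum, Complex.I_sq]
    field_simp
    ring
  have hpb : 0 < (Real.pi ^ 2 / b).re := by
    rw [show (Real.pi ^ 2 / b : ℂ) = ((Real.pi ^ 2 : ℝ) : ℂ) * b⁻¹ by push_cast; ring,
      Complex.re_ofReal_mul, Complex.inv_re]
    have hb0 : b ≠ 0 := by rintro rfl; simp at hb
    have := Complex.normSq_pos.mpr hb0
    positivity
  have key := hasSum_poisson_pi hgc hgi ?_ ?_ (M⁻¹ *ᵥ v)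
  · have hR : ∑' m : ι → ℤ, g (M⁻¹ *ᵥ v + fun i => (m i : ℝ)) = ∑' m : ι → ℤ,
        Complex.exp (-b * ∑ i, ((((M *ᵥ fun j => (m j : ℝ)) + v) i : ℝ) : ℂ) ^ 2) := by
      refine tsum_congr fun m => ?_
      simp only [g]
      rw [Matrix.mulVec_add, Matrix.mulVec_mulVec, Matrix.mul_nonsing_inv _ hu,
        Matrix.one_mulVec, add_comm v]
    rw [hR] at key
    refine key.congr_fun ?_
    intro k
    rw [hcoeff]
    have hd : ∑ i, (k i : ℂ) * ((M⁻¹ *ᵥ v) i : ℝ) =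
        ∑ i, ((M⁻¹ᵀ *ᵥ fun j => (k j : ℝ)) i : ℂ) * v i := by
      have : ∑ i, (k i : ℝ) * (M⁻¹ *ᵥ v) i = ∑ i, (M⁻¹ᵀ *ᵥ fun j => (k j : ℝ)) i * v i := by
        change (fun j => (k j : ℝ)) ⬝ᵥ (M⁻¹ *ᵥ v) = (M⁻¹ᵀ *ᵥ fun j => (k j : ℝ)) ⬝ᵥ v
        rw [Matrix.mulVec_transpose, Matrix.dotProduct_mulVec]
      exact_mod_cast congrArg (fun x : ℝ => (x : ℂ)) this
    rw [hd]
    ring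
  · intro R
    have hbd : ∃ K, ∀ x : ι → ℝ, ‖x‖ ≤ R → ∑ i, (M *ᵥ x) i ^ 2 ≤ K := by
      have hcont : Continuous fun x : ι → ℝ => ∑ i, (M *ᵥ x) i ^ 2 := by fun_prop
      obtain ⟨K, hK⟩ := (isCompact_closedBall (0 : ι → ℝ) R).bddAbove_image hcont.continuousOn
      exact ⟨K, fun x hx => hK ⟨x, by simpa using hx, rfl⟩⟩
    obtain ⟨K, hK⟩ := hbd
    refine ⟨fun m => Real.exp (b.re * K) *
      Real.exp (-(b.re / 2) * ∑ i, (M *ᵥ fun j => (m j : ℝ)) i ^ 2),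
      (hs _ (half_pos hb)).mul_left _, fun x hx m => ?_⟩
    simp only [g]
    rw [norm_cexp_neg_mul_sum, ← Real.exp_add]
    refine Real.exp_le_exp.mpr ?_
    have h1 : (∑ i, (M *ᵥ fun j => (m j : ℝ)) i ^ 2) ≤
        2 * ∑ i, (M *ᵥ (x + fun i => (m i : ℝ))) i ^ 2 + 2 * ∑ i, (M *ᵥ x) i ^ 2 := by
      rw [Finset.mul_sum, Finset.mul_sum, ← Finset.sum_add_distrib]
      refine Finset.sum_le_sum fun i _ => ?_
      rw [Matrix.mulVec_add, Pi.add_apply]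
      nlinarith [sq_nonneg (2 * (M *ᵥ x) i + (M *ᵥ fun j => (m j : ℝ)) i)]
    nlinarith [hK x hx]
  · simp_rw [hcoeff]
    refine Summable.mul_left _ (Summable.mul_left _ (Summable.of_norm ?_))
    simp_rw [norm_cexp_neg_mul_sum]
    exact hs' _ hpb

end GaussianPoisson

section UnimodularLattice

open Matrix

variable {n : ℕ} {L : AddSubgroup (Fin n → ℝ)} {c : ℝ}

theorem sum_mul_self_le (x : Fin n → ℝ) : ∑ i, x i * x i ≤ n * ‖x‖ ^ 2 := by
  calc ∑ i, x i * x i ≤ ∑ _i : Fin n, ‖x‖ ^ 2 := by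
        refine Finset.sum_le_sum fun i _ => ?_
        have := norm_le_pi_norm x i
        rw [← abs_mul_abs_self (x i), ← Real.norm_eq_abs, sq]
        gcongr
    _ = n * ‖x‖ ^ 2 := by simp

theorem norm_sq_le_sum_mul_self (x : Fin n → ℝ) : ‖x‖ ^ 2 ≤ ∑ i, x i * x i := by
  have h : ‖x‖ ≤ √(∑ i, x i * x i) := by
    refine (pi_norm_le_iff_of_nonneg (Real.sqrt_nonneg _)).mpr fun i => ?_
    rw [Real.norm_eq_abs, ← Real.sqrt_mul_self_eq_abs]
    exact Real.sqrt_le_sqrt (Finset.single_le_sum (f := fun i => x i * x i)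
      (fun j _ => mul_self_nonneg (x j)) (Finset.mem_univ i))
  calc ‖x‖ ^ 2 ≤ √(∑ i, x i * x i) ^ 2 := by gcongr
    _ = _ := Real.sq_sqrt (Finset.sum_nonneg fun i _ => mul_self_nonneg (x i))

theorem discreteTopology_of_forall_le_sum (hc : 0 < c)
    (hmin : ∀ x ∈ L, x ≠ 0 → c ≤ ∑ i, x i * x i) : DiscreteTopology L := by
  refine discreteTopology_of_isOpen_singleton_zero ?_
  rw [Metric.isOpen_iff]
  rintro x rfl
  refine ⟨√(c / (n + 1)), by positivity, fun y hy => ?_⟩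
  rw [mem_ball_zero_iff] at hy
  by_contra hne
  have h1 := hmin y y.2 (by simpa using hne)
  have h2 := sum_mul_self_le (y : Fin n → ℝ)
  have h3 : ‖(y : Fin n → ℝ)‖ ^ 2 < c / (n + 1) := by
    rw [← Real.sq_sqrt (show 0 ≤ c / (n + 1) by positivity)]
    have : ‖(y : Fin n → ℝ)‖ < √(c / (n + 1)) := hy
    gcongr
  rw [lt_div_iff₀ (by positivity)] at h3
  nlinarith [sq_nonneg ‖(y : Fin n → ℝ)‖]

theorem span_eq_top_of_unimodular (huni : (L : Set (Fin n → ℝ)) = dualLattice L) (hc : 0 < c)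
    (hmin : ∀ x ∈ L, x ≠ 0 → c ≤ ∑ i, x i * x i) :
    Submodule.span ℝ (L : Set (Fin n → ℝ)) = ⊤ := by
  by_contra hne
  obtain ⟨f, hf0, hf⟩ := Submodule.exists_le_ker_of_lt_top _ (lt_top_iff_ne_top.mpr hne)
  set u : Fin n → ℝ := fun i => f (Pi.single i 1) with hu
  have hfu : ∀ x, f x = ∑ i, u i * x i := by
    intro x
    conv_lhs => rw [← Finset.univ_sum_single x, map_sum]
    refine Finset.sum_congr rfl fun i _ => ?_
    rw [show Pi.single i (x i) = x i • Pi.single i (1 : ℝ) by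
      rw [← Pi.single_smul, smul_eq_mul, mul_one], map_smul, smul_eq_mul, mul_comm]
  have hu0 : u ≠ 0 := by
    rintro h
    exact hf0 (LinearMap.ext fun x => by simp [hfu, h])
  have hmem : ∀ t : ℝ, t • u ∈ L := by
    intro t
    rw [← SetLike.mem_coe, huni]
    intro w hw
    have h0 : f w = 0 := hf (Submodule.subset_span hw)
    refine ⟨0, ?_⟩
    simp only [Pi.smul_apply, smul_eq_mul, mul_assoc, ← Finset.mul_sum]
    rw [← hfu, h0]
    simp
  have hpos : 0 < ∑ i, u i * u i := by
    have := norm_sq_le_sum_mul_self u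
    have h2 : 0 < ‖u‖ := norm_pos_iff.mpr hu0
    nlinarith
  set q := ∑ i, u i * u i with hq
  have ht : 0 < √(c / (2 * q)) := by positivity
  have h := hmin _ (hmem (√(c / (2 * q)))) (smul_ne_zero ht.ne' hu0)
  have h2 : ∑ i, (√(c / (2 * q)) • u) i * (√(c / (2 * q)) • u) i = c / (2 * q) * q := by
    conv_rhs => rw [← Real.mul_self_sqrt (show 0 ≤ c / (2 * q) by positivity)]
    generalize √(c / (2 * q)) = t
    rw [hq, Finset.mul_sum]
    refine Finset.sum_congr rfl fun i _ => ?_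
    simp only [Pi.smul_apply, smul_eq_mul]
    ring
  rw [h2] at h
  have : c / (2 * q) * q = c / 2 := by field_simp
  linarith

/-- Parametrizations of a unimodular lattice by a basis matrix and by its inverse transpose. -/
theorem exists_matrix_of_unimodular (huni : (L : Set (Fin n → ℝ)) = dualLattice L) (hc : 0 < c)
    (hmin : ∀ x ∈ L, x ≠ 0 → c ≤ ∑ i, x i * x i) :
    ∃ M : Matrix (Fin n) (Fin n) ℝ, M.det ≠ 0 ∧
      (∃ e : (Fin n → ℤ) ≃ L, ∀ m, (e m : Fin n → ℝ) = M *ᵥ fun j => (m j : ℝ)) ∧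
      ∃ e : (Fin n → ℤ) ≃ L, ∀ m, (e m : Fin n → ℝ) = M⁻¹ᵀ *ᵥ fun j => (m j : ℝ) := by
  have hd : DiscreteTopology (AddSubgroup.toIntSubmodule L) :=
    discreteTopology_of_forall_le_sum hc hmin
  have hZ : IsZLattice ℝ (AddSubgroup.toIntSubmodule L) :=
    ⟨span_eq_top_of_unimodular huni hc hmin⟩
  have hfree : Module.Free ℤ (AddSubgroup.toIntSubmodule L) :=
    ZLattice.module_free ℝ _
  have hfin : Module.Finite ℤ (AddSubgroup.toIntSubmodule L) :=
    ZLattice.module_finite ℝ _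
  have hrank : Module.finrank ℤ (AddSubgroup.toIntSubmodule L) = n := by
    rw [ZLattice.rank ℝ]; simp
  let b : Module.Basis (Fin n) ℤ (AddSubgroup.toIntSubmodule L) :=
    Module.finBasisOfFinrankEq _ _ hrank
  let M : Matrix (Fin n) (Fin n) ℝ := Matrix.of fun i j => (b j : Fin n → ℝ) i
  have hM : ∀ m : Fin n → ℤ, ((b.equivFun.symm m : _) : Fin n → ℝ) =
      M *ᵥ fun j => (m j : ℝ) := by
    intro m
    ext i
    simp [M, Module.Basis.equivFun_symm_apply, Matrix.mulVec, dotProduct, Finset.sum_apply,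
      mul_comm]
  have hdet : M.det ≠ 0 := by
    have h1 : M = (Pi.basisFun ℝ (Fin n)).toMatrix (b.ofZLatticeBasis ℝ _) := by
      ext i j
      simp [M, Module.Basis.toMatrix_apply]
    rw [h1]
    have := (Pi.basisFun ℝ (Fin n)).invertibleToMatrix (b.ofZLatticeBasis ℝ _)
    exact (Matrix.isUnit_det_of_invertible _).ne_zero
  have hu : IsUnit M.det := hdet.isUnit
  refine ⟨M, hdet, ⟨b.equivFun.symm.toEquiv, hM⟩, ?_⟩
  have hmem : ∀ m : Fin n → ℤ, (M⁻¹ᵀ *ᵥ fun j => (m j : ℝ)) ∈ L := by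
    intro m
    rw [← SetLike.mem_coe, huni]
    intro w hw
    obtain ⟨k, h⟩ : ∃ k : Fin n → ℤ, w = M *ᵥ fun j => (k j : ℝ) :=
      ⟨b.equivFun ⟨w, hw⟩, by rw [← hM, LinearEquiv.symm_apply_apply]⟩
    refine ⟨∑ i, m i * k i, ?_⟩
    change (M⁻¹ᵀ *ᵥ fun j => (m j : ℝ)) ⬝ᵥ w = _
    rw [h, Matrix.mulVec_transpose, ← Matrix.dotProduct_mulVec, Matrix.mulVec_mulVec,
        Matrix.nonsing_inv_mul _ hu, Matrix.one_mulVec]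
    simp [dotProduct]
  refine ⟨Equiv.ofBijective (fun m => ⟨_, hmem m⟩) ⟨fun m m' h => ?_, fun x => ?_⟩, fun m => rfl⟩
  · have h' := congrArg (fun y : L => Mᵀ *ᵥ (y : Fin n → ℝ)) h
    simp only [Matrix.mulVec_mulVec, ← Matrix.transpose_mul, Matrix.nonsing_inv_mul _ hu,
      Matrix.transpose_one, Matrix.one_mulVec] at h'
    ext i
    exact_mod_cast congrFun h' i
  · have hx : (x : Fin n → ℝ) ∈ dualLattice (L : Set (Fin n → ℝ)) := huni ▸ x.2
    choose m hm using fun j => hx (b j) (b j).2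
    refine ⟨m, Subtype.ext ?_⟩
    have h2 : (fun j => (m j : ℝ)) = Mᵀ *ᵥ (x : Fin n → ℝ) := by
      ext j
      rw [← hm j]
      simp [M, Matrix.mulVec, dotProduct, mul_comm]
    change (M⁻¹ᵀ *ᵥ fun j => (m j : ℝ)) = _
    rw [h2, Matrix.mulVec_mulVec, ← Matrix.transpose_mul, Matrix.mul_nonsing_inv _ hu,
      Matrix.transpose_one, Matrix.one_mulVec]

theorem summable_exp_neg_mul_sum (hc : 0 < c)
    (hmin : ∀ x ∈ L, x ≠ 0 → c ≤ ∑ i, x i * x i) {a : ℝ} (ha : 0 < a) (v : Fin n → ℝ) :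
    Summable fun x : L => Real.exp (-a * ∑ i, ((x : Fin n → ℝ) i + v i) ^ 2) := by
  have hd : DiscreteTopology (AddSubgroup.toIntSubmodule L) :=
    discreteTopology_of_forall_le_sum hc hmin
  set r := Module.finrank ℤ (AddSubgroup.toIntSubmodule L) + 1 with hr
  have h : Summable fun x : AddSubgroup.toIntSubmodule L =>
      ‖(x : Fin n → ℝ) - (-v)‖⁻¹ ^ (2 * r) :=
    ZLattice.summable_norm_sub_inv_pow (AddSubgroup.toIntSubmodule L) (2 * r) (by lia)
      (-v)
  have h2 : Summable fun x : L => (r.factorial / a ^ r) * ‖(x : Fin n → ℝ) - (-v)‖⁻¹ ^ (2 * r) :=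
    Summable.mul_left _ h
  refine h2.of_norm_bounded_eventually ?_
  have hfin : {x : L | (x : Fin n → ℝ) - (-v) = 0}.Finite := by
    refine Set.Subsingleton.finite fun x hx y hy => Subtype.ext ?_
    exact (sub_eq_zero.mp hx).trans (sub_eq_zero.mp hy).symm
  filter_upwards [hfin.compl_mem_cofinite] with x hx
  have hx0 : 0 < ‖(x : Fin n → ℝ) - (-v)‖ := norm_pos_iff.mpr hx
  set N := ‖(x : Fin n → ℝ) - (-v)‖ with hN
  have h3 : N ^ 2 ≤ ∑ i, ((x : Fin n → ℝ) i + v i) ^ 2 := by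
    have := norm_sq_le_sum_mul_self ((x : Fin n → ℝ) - (-v))
    rw [hN]
    simpa [← sq] using this
  rw [Real.norm_of_nonneg (Real.exp_nonneg _)]
  have h4 : (a * N ^ 2) ^ r / r.factorial ≤ Real.exp (a * N ^ 2) :=
    Real.pow_div_factorial_le_exp _ (by positivity) r
  calc Real.exp (-a * ∑ i, ((x : Fin n → ℝ) i + v i) ^ 2) ≤ Real.exp (-(a * N ^ 2)) := by
        refine Real.exp_le_exp.mpr ?_
        nlinarith
    _ = (Real.exp (a * N ^ 2))⁻¹ := Real.exp_neg _
    _ ≤ ((a * N ^ 2) ^ r / r.factorial)⁻¹ := by gcongr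
    _ = _ := by
      rw [mul_pow, ← pow_mul, inv_pow]
      field_simp

end UnimodularLattice

section LatticeTheta

open Matrix

/-- The theta series `∑ exp(π i τ N(x))` of a norm function `N`. -/
noncomputable def thetaSeries {X : Type*} (N : X → ℝ) (τ : ℂ) : ℂ :=
  ∑' x, Complex.exp (Real.pi * Complex.I * τ * N x)

theorem norm_cexp_pi_I_mul (τ : ℂ) (r : ℝ) :
    ‖Complex.exp (Real.pi * Complex.I * τ * r)‖ = Real.exp (-(Real.pi * τ.im) * r) := by
  rw [Complex.norm_exp]
  congr 1
  simp

section Characteristic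

variable {n : ℕ} {L : AddSubgroup (Fin n → ℝ)}

theorem exists_int_sum_mul (huni : (L : Set (Fin n → ℝ)) = dualLattice L) {x y : Fin n → ℝ}
    (hx : x ∈ L) (hy : y ∈ L) : ∃ m : ℤ, ∑ i, x i * y i = m := by
  rw [← SetLike.mem_coe, huni] at hx
  exact hx y hy

theorem mem_of_forall_exists_int (huni : (L : Set (Fin n → ℝ)) = dualLattice L)
    {x : Fin n → ℝ} (h : ∀ y ∈ L, ∃ m : ℤ, ∑ i, x i * y i = m) : x ∈ L := by
  rw [← SetLike.mem_coe, huni]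
  exact h

theorem sum_add_mul_self (x y : Fin n → ℝ) : ∑ i, (x + y) i * (x + y) i =
    ∑ i, x i * x i + ∑ i, y i * y i + 2 * ∑ i, x i * y i := by
  rw [Finset.mul_sum, ← Finset.sum_add_distrib, ← Finset.sum_add_distrib]
  refine Finset.sum_congr rfl fun i _ => ?_
  simp only [Pi.add_apply]
  ring

theorem exists_half_characteristic {c : ℝ} (huni : (L : Set (Fin n → ℝ)) = dualLattice L)
    (hc : 0 < c) (hmin : ∀ x ∈ L, x ≠ 0 → c ≤ ∑ i, x i * x i) :
    ∃ v : Fin n → ℝ, ∀ x ∈ L, ∃ m : ℤ, 2 * ∑ i, x i * v i = ∑ i, x i * x i + 2 * m := by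
  obtain ⟨M, hM, ⟨e, he⟩, -⟩ := exists_matrix_of_unimodular huni hc hmin
  let β : Fin n → Fin n → ℝ := fun j => Mᵀ j
  let v : Fin n → ℝ := M⁻¹ᵀ *ᵥ fun j => (∑ i, β j i * β j i) / 2
  let H : AddSubgroup (Fin n → ℝ) :=
    { carrier := {x | x ∈ L ∧ ∃ m : ℤ, 2 * ∑ i, x i * v i = ∑ i, x i * x i + 2 * m}
      zero_mem' := ⟨L.zero_mem, 0, by simp⟩
      add_mem' := by
        rintro x y ⟨hx, m, hm⟩ ⟨hy, k, hk⟩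
        obtain ⟨l, hl⟩ := exists_int_sum_mul huni hx hy
        refine ⟨L.add_mem hx hy, m + k - l, ?_⟩
        rw [sum_add_mul_self, hl]
        simp only [Pi.add_apply, add_mul, Finset.sum_add_distrib, mul_add, hm, hk]
        push_cast
        ring
      neg_mem' := by
        rintro x ⟨hx, m, hm⟩
        obtain ⟨l, hl⟩ := exists_int_sum_mul huni hx hx
        refine ⟨L.neg_mem hx, - m - l, ?_⟩
        simp only [Pi.neg_apply, neg_mul, mul_neg, neg_neg, Finset.sum_neg_distrib]
        push_cast
        linarith }
  have hβ : ∀ j, β j ∈ H := by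
    intro j
    have h1 : β j = M *ᵥ fun k => ((Pi.single j 1 : Fin n → ℤ) k : ℝ) := by
      ext i
      simp [β, Matrix.mulVec, dotProduct, Pi.single_apply]
    refine ⟨?_, 0, ?_⟩
    · rw [h1, ← he]
      exact (e _).2
    · have h2 : ∀ j, ∑ i, β j i * v i = (∑ i, β j i * β j i) / 2 := by
        intro j
        have : Mᵀ *ᵥ v = fun j => (∑ i, β j i * β j i) / 2 := by
          simp only [v]
          rw [Matrix.mulVec_mulVec, ← Matrix.transpose_mul,
            Matrix.nonsing_inv_mul _ hM.isUnit, Matrix.transpose_one, Matrix.one_mulVec]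
        exact congrFun this j
      rw [h2]
      simp only [Int.cast_zero]
      ring
  refine ⟨v, fun x hx => ?_⟩
  suffices x ∈ H from this.2
  have hx' : x = ∑ j, (e.symm ⟨x, hx⟩ j) • β j := by
    have h3 := he (e.symm ⟨x, hx⟩)
    rw [Equiv.apply_symm_apply] at h3
    simp only at h3
    refine h3.trans ?_
    ext i
    simp [β, Matrix.mulVec, dotProduct, Finset.sum_apply, mul_comm]
  rw [hx']
  exact H.sum_mem fun j _ => H.zsmul_mem (hβ j) _

theorem mem_shadow_iff (huni : (L : Set (Fin n → ℝ)) = dualLattice L)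
    (hodd : ∃ x ∈ L, ¬ ∃ m : ℤ, ∑ i, x i * x i = ((2 * m : ℤ) : ℝ))
    {v : Fin n → ℝ}
    (hv : ∀ x ∈ L, ∃ m : ℤ, 2 * ∑ i, x i * v i = ∑ i, x i * x i + 2 * m) (s : Fin n → ℝ) :
    s ∈ shadow (L : Set (Fin n → ℝ)) ↔ s - v ∈ L := by
  obtain ⟨x₀, hx₀, hodd⟩ := hodd
  obtain ⟨q₀, hq₀⟩ := exists_int_sum_mul huni hx₀ hx₀
  obtain ⟨m₀, hm₀⟩ := hv x₀ hx₀
  have hq₀o : Odd q₀ := by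
    rw [← Int.not_even_iff_odd]
    rintro ⟨r, hr⟩
    exact hodd ⟨r, by rw [hq₀, hr, two_mul]⟩
  constructor
  · rintro ⟨hs, hsL⟩
    have heven : ∀ x ∈ L, ∀ r : ℤ, ∑ i, x i * x i = ((2 * r : ℤ) : ℝ) →
        ∃ m : ℤ, ∑ i, s i * x i = m := fun x hx r hr => hs x ⟨hx, r, hr⟩
    have hsub : ∀ x ∈ L, (¬ ∃ r : ℤ, ∑ i, x i * x i = ((2 * r : ℤ) : ℝ)) →
        ∃ m : ℤ, ∑ i, s i * x i = ∑ i, s i * x₀ i + m := by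
      intro x hx hxo
      obtain ⟨a, ha⟩ := exists_int_sum_mul huni hx hx
      obtain ⟨d, hd⟩ := exists_int_sum_mul huni hx (L.neg_mem hx₀)
      have hao : Odd a := by
        rw [← Int.not_even_iff_odd]
        rintro ⟨r, hr⟩
        exact hxo ⟨r, by rw [ha, hr, two_mul]⟩
      obtain ⟨r, hr⟩ := hao.add_odd hq₀o
      obtain ⟨m, hm⟩ := heven (x + -x₀) (L.add_mem hx (L.neg_mem hx₀)) (r + d) (by
        rw [sum_add_mul_self, ha, hd]
        simp only [Pi.neg_apply, neg_mul_neg]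
        rw [hq₀]
        have : (a : ℝ) + q₀ = r + r := by exact_mod_cast hr
        push_cast
        linarith)
      refine ⟨m, ?_⟩
      rw [← hm, ← Finset.sum_add_distrib]
      refine Finset.sum_congr rfl fun i _ => ?_
      simp only [Pi.add_apply, Pi.neg_apply]
      ring
    obtain ⟨t, ht⟩ := heven (x₀ + x₀) (L.add_mem hx₀ hx₀) (2 * q₀) (by
      rw [sum_add_mul_self, hq₀]
      push_cast
      ring)
    have ht2 : 2 * ∑ i, s i * x₀ i = t := by
      rw [← ht, Finset.mul_sum]
      refine Finset.sum_congr rfl fun i _ => ?_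
      simp only [Pi.add_apply]
      ring
    have hto : Odd t := by
      rw [← Int.not_even_iff_odd]
      rintro ⟨r, hr⟩
      refine hsL (mem_of_forall_exists_int huni fun x hx => ?_)
      by_cases hxe : ∃ r : ℤ, ∑ i, x i * x i = ((2 * r : ℤ) : ℝ)
      · obtain ⟨k, hk⟩ := hxe
        exact heven x hx k hk
      · obtain ⟨m, hm⟩ := hsub x hx hxe
        refine ⟨r + m, ?_⟩
        rw [hr] at ht2
        push_cast at ht2 ⊢
        linarith
    refine mem_of_forall_exists_int huni fun x hx => ?_
    obtain ⟨k, hk⟩ := hv x hx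
    have hsv : ∑ i, (s - v) i * x i = ∑ i, s i * x i - ∑ i, x i * v i := by
      rw [← Finset.sum_sub_distrib]
      refine Finset.sum_congr rfl fun i _ => ?_
      simp only [Pi.sub_apply]
      ring
    rw [hsv]
    by_cases hxe : ∃ r : ℤ, ∑ i, x i * x i = ((2 * r : ℤ) : ℝ)
    · obtain ⟨r, hr⟩ := hxe
      obtain ⟨m, hm⟩ := heven x hx r hr
      refine ⟨m - r - k, ?_⟩
      push_cast at hr ⊢
      linarith
    · obtain ⟨m, hm⟩ := hsub x hx hxe
      obtain ⟨a, ha⟩ := exists_int_sum_mul huni hx hx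
      have hao : Odd a := by
        rw [← Int.not_even_iff_odd]
        rintro ⟨r, hr⟩
        exact hxe ⟨r, by rw [ha, hr, two_mul]⟩
      obtain ⟨r, hr⟩ := hto.sub_odd hao
      refine ⟨r + m - k, ?_⟩
      have hr' : (t : ℝ) - a = r + r := by exact_mod_cast hr
      push_cast
      linarith
  · intro hs
    refine ⟨?_, fun hsL => ?_⟩
    · rintro x ⟨hx, r, hr⟩
      obtain ⟨m, hm⟩ := exists_int_sum_mul huni hs hx
      obtain ⟨k, hk⟩ := hv x hx
      have hsv : ∑ i, (s - v) i * x i = ∑ i, s i * x i - ∑ i, x i * v i := by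
        rw [← Finset.sum_sub_distrib]
        refine Finset.sum_congr rfl fun i _ => ?_
        simp only [Pi.sub_apply]
        ring
      refine ⟨m + r + k, ?_⟩
      push_cast at hr ⊢
      linarith
    · have hvL : v ∈ L := by simpa using L.sub_mem hsL hs
      obtain ⟨m, hm⟩ := exists_int_sum_mul huni hx₀ hvL
      refine hodd ⟨m - m₀, ?_⟩
      push_cast
      linarith

end Characteristic

end LatticeTheta

section LatticeTheta

open Matrix

section FunctionalEquation

variable {L : AddSubgroup (Fin 36 → ℝ)} {c : ℝ}

theorem pi_div_neg_pi_I_mul_cpow {τ : ℂ} (hτ : 0 < τ.im) :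
    (Real.pi / (-(Real.pi * Complex.I * τ)) : ℂ) ^ ((Fintype.card (Fin 36) : ℂ) / 2) =
      -(τ ^ 18)⁻¹ := by
  have hτ0 : τ ≠ 0 := by rintro rfl; simp at hτ
  have hpi : (Real.pi : ℂ) ≠ 0 := by exact_mod_cast Real.pi_ne_zero
  have h1 : (Real.pi / (-(Real.pi * Complex.I * τ)) : ℂ) = Complex.I * τ⁻¹ := by
    have := Complex.I_mul_I
    field_simp
    linear_combination -this
  have h2 : ((Fintype.card (Fin 36) : ℂ) / 2) = ((18 : ℕ) : ℂ) := by
    rw [Fintype.card_fin]; norm_num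
  rw [h1, h2, Complex.cpow_natCast, mul_pow, inv_pow]
  rw [show Complex.I ^ 18 = (Complex.I ^ 2) ^ 9 by ring, Complex.I_sq]
  ring

theorem exists_tsum_lattice_eq (huni : (L : Set (Fin 36 → ℝ)) = dualLattice L) (hc : 0 < c)
    (hmin : ∀ x ∈ L, x ≠ 0 → c ≤ ∑ i, x i * x i) :
    ∃ κ : ℂ, ∀ (v : Fin 36 → ℝ) (τ : ℂ), 0 < τ.im →
      ∑' x : L, Complex.exp (Real.pi * Complex.I * τ *
        ((∑ i, ((x : Fin 36 → ℝ) + v) i * ((x : Fin 36 → ℝ) + v) i : ℝ) : ℂ)) =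
      κ * (-(τ ^ 18)⁻¹ * ∑' y : L, Complex.exp (Real.pi * Complex.I * (-1 / τ) *
          ((∑ i, (y : Fin 36 → ℝ) i * (y : Fin 36 → ℝ) i : ℝ) : ℂ)) *
        Complex.exp (2 * Real.pi * Complex.I * ((∑ i, (y : Fin 36 → ℝ) i * v i : ℝ) : ℂ))) := by
  obtain ⟨M, hM, ⟨e, he⟩, ⟨e', he'⟩⟩ := exists_matrix_of_unimodular huni hc hmin
  have hs : ∀ (f : (Fin 36 → ℤ) ≃ L) (a : ℝ), 0 < a → Summable fun m =>
      Real.exp (-a * ∑ i, (f m : Fin 36 → ℝ) i ^ 2) := by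
    intro f a ha
    have := summable_exp_neg_mul_sum hc hmin ha 0
    simpa [Function.comp_def] using (f.summable_iff).mpr this
  refine ⟨(|M.det⁻¹| : ℝ), fun v τ hτ => ?_⟩
  have hb : 0 < (-(Real.pi * Complex.I * τ)).re := by
    simp only [Complex.neg_re, Complex.mul_re, Complex.mul_im, Complex.ofReal_re,
      Complex.ofReal_im, Complex.I_re, Complex.I_im]
    simp only [mul_zero, zero_mul, mul_one, sub_self, zero_sub, add_zero, neg_neg]
    have := Real.pi_pos
    positivity
  have hτ0 : τ ≠ 0 := by rintro rfl; simp at hτ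
  have hpi : (Real.pi : ℂ) ≠ 0 := by exact_mod_cast Real.pi_ne_zero
  have key := (hasSum_gaussian_poisson hM
    (fun a ha => by simpa only [he] using hs e a ha)
    (fun a ha => by simpa only [he'] using hs e' a ha) hb v).tsum_eq
  rw [← e.tsum_eq, ← e'.tsum_eq, ← tsum_mul_left, ← tsum_mul_left]
  refine Eq.trans (tsum_congr fun m => ?_) (key.symm.trans (tsum_congr fun k => ?_))
  · rw [← he, neg_neg]
    push_cast
    simp only [← sq]
  · rw [← he', pi_div_neg_pi_I_mul_cpow hτ]
    have h3 : -(Real.pi ^ 2 / -(Real.pi * Complex.I * τ) : ℂ) =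
        Real.pi * Complex.I * (-1 / τ) := by
      have := Complex.I_mul_I
      field_simp
      linear_combination this
    rw [h3]
    push_cast
    simp only [← sq]
    ring

theorem thetaSeries_I_ne_zero {X : Type*} [Nonempty X] {N : X → ℝ}
    (hs : Summable fun x => Real.exp (-Real.pi * N x)) : thetaSeries N Complex.I ≠ 0 := by
  have h : thetaSeries N Complex.I = ((∑' x, Real.exp (-Real.pi * N x) : ℝ) : ℂ) := by
    rw [Complex.ofReal_tsum]
    refine tsum_congr fun x => ?_
    push_cast
    congr 1
    linear_combination (Real.pi * N x : ℂ) * Complex.I_mul_I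
  rw [h]
  have := hs.tsum_pos (fun x => (Real.exp_pos _).le) (Classical.arbitrary X) (Real.exp_pos _)
  exact_mod_cast this.ne'

theorem tsum_lattice_eq (huni : (L : Set (Fin 36 → ℝ)) = dualLattice L) (hc : 0 < c)
    (hmin : ∀ x ∈ L, x ≠ 0 → c ≤ ∑ i, x i * x i) (v : Fin 36 → ℝ) {τ : ℂ} (hτ : 0 < τ.im) :
      ∑' x : L, Complex.exp (Real.pi * Complex.I * τ *
        ((∑ i, ((x : Fin 36 → ℝ) + v) i * ((x : Fin 36 → ℝ) + v) i : ℝ) : ℂ)) =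
      -(τ ^ 18)⁻¹ * ∑' y : L, Complex.exp (Real.pi * Complex.I * (-1 / τ) *
          ((∑ i, (y : Fin 36 → ℝ) i * (y : Fin 36 → ℝ) i : ℝ) : ℂ)) *
        Complex.exp (2 * Real.pi * Complex.I * ((∑ i, (y : Fin 36 → ℝ) i * v i : ℝ) : ℂ)) := by
  obtain ⟨κ, hκ⟩ := exists_tsum_lattice_eq huni hc hmin
  have hne : thetaSeries (fun x : L => ∑ i, (x : Fin 36 → ℝ) i * (x : Fin 36 → ℝ) i)
      Complex.I ≠ 0 := by
    refine thetaSeries_I_ne_zero ?_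
    simpa [sq] using summable_exp_neg_mul_sum hc hmin Real.pi_pos 0
  have h := hκ 0 Complex.I (by simp)
  have h1 : -1 / Complex.I = Complex.I := by
    rw [div_eq_iff Complex.I_ne_zero, Complex.I_mul_I]
  have h2 : -(Complex.I ^ 18)⁻¹ = 1 := by
    rw [show Complex.I ^ 18 = (Complex.I ^ 2) ^ 9 by ring, Complex.I_sq]
    norm_num
  rw [h1, h2] at h
  simp only [add_zero, Pi.zero_apply, mul_zero, Finset.sum_const_zero, Complex.ofReal_zero,
    Complex.exp_zero, mul_one, one_mul] at h
  have hκ1 : κ = 1 := mul_right_cancel₀ hne (by rw [one_mul]; exact h.symm)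
  rw [hκ v τ hτ, hκ1, one_mul]

theorem thetaSeries_lattice_eq (huni : (L : Set (Fin 36 → ℝ)) = dualLattice L) (hc : 0 < c)
    (hmin : ∀ x ∈ L, x ≠ 0 → c ≤ ∑ i, x i * x i) {τ : ℂ} (hτ : 0 < τ.im) :
    thetaSeries (fun x : L => ∑ i, (x : Fin 36 → ℝ) i * (x : Fin 36 → ℝ) i) τ =
      -(τ ^ 18)⁻¹ *
        thetaSeries (fun x : L => ∑ i, (x : Fin 36 → ℝ) i * (x : Fin 36 → ℝ) i) (-1 / τ) := by
  simpa [thetaSeries] using tsum_lattice_eq huni hc hmin 0 hτ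

theorem thetaSeries_lattice_add_two (huni : (L : Set (Fin 36 → ℝ)) = dualLattice L) (τ : ℂ) :
    thetaSeries (fun x : L => ∑ i, (x : Fin 36 → ℝ) i * (x : Fin 36 → ℝ) i) (τ + 2) =
      thetaSeries (fun x : L => ∑ i, (x : Fin 36 → ℝ) i * (x : Fin 36 → ℝ) i) τ := by
  refine tsum_congr fun x => ?_
  obtain ⟨m, hm⟩ := exists_int_sum_mul huni x.2 x.2
  rw [Complex.exp_eq_exp_iff_exists_int]
  refine ⟨m, ?_⟩
  simp only [hm, Complex.ofReal_intCast]
  ring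

/-- A shadow vector contributes to the lattice coset of a half characteristic vector. -/
noncomputable def shadowEquiv (huni : (L : Set (Fin 36 → ℝ)) = dualLattice L)
    (hodd : ∃ x ∈ L, ¬ ∃ m : ℤ, ∑ i, x i * x i = ((2 * m : ℤ) : ℝ)) {v : Fin 36 → ℝ}
    (hv : ∀ x ∈ L, ∃ m : ℤ, 2 * ∑ i, x i * v i = ∑ i, x i * x i + 2 * m) :
    L ≃ shadow (L : Set (Fin 36 → ℝ)) where
  toFun x := ⟨x + v, (mem_shadow_iff huni hodd hv _).mpr (by simp)⟩
  invFun s := ⟨s - v, (mem_shadow_iff huni hodd hv _).mp s.2⟩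
  left_inv x := by simp
  right_inv s := by simp

theorem thetaSeries_shadow_eq (huni : (L : Set (Fin 36 → ℝ)) = dualLattice L) (hc : 0 < c)
    (hmin : ∀ x ∈ L, x ≠ 0 → c ≤ ∑ i, x i * x i)
    (hodd : ∃ x ∈ L, ¬ ∃ m : ℤ, ∑ i, x i * x i = ((2 * m : ℤ) : ℝ)) {τ : ℂ} (hτ : 0 < τ.im) :
    thetaSeries (fun s : shadow (L : Set (Fin 36 → ℝ)) =>
        ∑ i, (s : Fin 36 → ℝ) i * (s : Fin 36 → ℝ) i) τ =
      -(τ ^ 18)⁻¹ *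
        thetaSeries (fun x : L => ∑ i, (x : Fin 36 → ℝ) i * (x : Fin 36 → ℝ) i) (-1 / τ + 1) := by
  obtain ⟨v, hv⟩ := exists_half_characteristic huni hc hmin
  rw [thetaSeries, ← (shadowEquiv huni hodd hv).tsum_eq]
  refine (tsum_lattice_eq huni hc hmin v hτ).trans ?_
  congr 1
  refine tsum_congr fun x => ?_
  obtain ⟨m, hm⟩ := hv x x.2
  rw [← Complex.exp_add, Complex.exp_eq_exp_iff_exists_int]
  refine ⟨m, ?_⟩
  have h : 2 * ((∑ i, (x : Fin 36 → ℝ) i * v i : ℝ) : ℂ) =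
      ((∑ i, (x : Fin 36 → ℝ) i * (x : Fin 36 → ℝ) i : ℝ) : ℂ) + 2 * m := by
    rw [← Complex.ofReal_ofNat, ← Complex.ofReal_mul, hm]
    push_cast
    ring
  linear_combination (Real.pi * Complex.I) * h

theorem summable_exp_shadow (huni : (L : Set (Fin 36 → ℝ)) = dualLattice L) (hc : 0 < c)
    (hmin : ∀ x ∈ L, x ≠ 0 → c ≤ ∑ i, x i * x i)
    (hodd : ∃ x ∈ L, ¬ ∃ m : ℤ, ∑ i, x i * x i = ((2 * m : ℤ) : ℝ)) {a : ℝ} (ha : 0 < a) :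
    Summable fun s : shadow (L : Set (Fin 36 → ℝ)) =>
      Real.exp (-a * ∑ i, (s : Fin 36 → ℝ) i * (s : Fin 36 → ℝ) i) := by
  obtain ⟨v, hv⟩ := exists_half_characteristic huni hc hmin
  rw [← (shadowEquiv huni hodd hv).summable_iff]
  refine (summable_exp_neg_mul_sum hc hmin ha v).congr fun x => ?_
  simp only [← sq]
  rfl

theorem sum_mul_self_lattice_cases (huni : (L : Set (Fin 36 → ℝ)) = dualLattice L)
    (hmin : ∀ x ∈ L, x ≠ 0 → (4 : ℝ) ≤ ∑ i, x i * x i) {x : Fin 36 → ℝ} (hx : x ∈ L) :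
    x = 0 ∨ ∑ i, x i * x i = 4 ∨ 5 ≤ ∑ i, x i * x i := by
  by_cases h0 : x = 0
  · exact .inl h0
  obtain ⟨m, hm⟩ := exists_int_sum_mul huni hx hx
  have h4 := hmin x hx h0
  rw [hm] at h4 ⊢
  have h4' : 4 ≤ m := by exact_mod_cast h4
  rcases h4'.eq_or_lt with h | h
  · exact .inr (.inl (by rw [← h]; norm_num))
  · exact .inr (.inr (by exact_mod_cast h))

theorem sum_mul_self_shadow_cases (huni : (L : Set (Fin 36 → ℝ)) = dualLattice L)
    (hmin : ∀ x ∈ L, x ≠ 0 → (4 : ℝ) ≤ ∑ i, x i * x i) {s : Fin 36 → ℝ}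
    (hs : s ∈ shadow (L : Set (Fin 36 → ℝ))) :
    ∑ i, s i * s i = 1 ∨ 5 / 4 ≤ ∑ i, s i * s i := by
  have hsL : s + s ∈ L := by
    refine mem_of_forall_exists_int huni fun x hx => ?_
    obtain ⟨q, hq⟩ := exists_int_sum_mul huni hx hx
    obtain ⟨m, hm⟩ := hs.1 (x + x) ⟨L.add_mem hx hx, 2 * q, by
      rw [sum_add_mul_self, hq]
      push_cast
      ring⟩
    refine ⟨m, ?_⟩
    rw [← hm]
    refine Finset.sum_congr rfl fun i _ => ?_
    simp only [Pi.add_apply]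
    ring
  have h0 : s + s ≠ 0 := by
    intro h
    have : s = 0 := by
      ext i
      have := congrFun h i
      simp only [Pi.add_apply, Pi.zero_apply] at this ⊢
      linarith
    exact hs.2 (this ▸ L.zero_mem)
  have h4 := sum_add_mul_self s s
  rcases sum_mul_self_lattice_cases huni hmin hsL with h | h | h
  · exact absurd h h0
  · left; linarith
  · right; linarith

end FunctionalEquation

end LatticeTheta

section ModularVanishing

open UpperHalfPlane ModularForm ModularGroup MatrixGroups OnePoint Filter Asymptotics
open scoped Topology Manifold

theorem coe_S_smul (τ : ℍ) : ((S • τ : ℍ) : ℂ) = -1 / τ := by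
  rw [modular_S_smul]
  change (-(τ : ℂ))⁻¹ = _
  rw [inv_neg, neg_div, one_div]

theorem coe_T_smul (τ : ℍ) : ((T • τ : ℍ) : ℂ) = τ + 1 := by
  rw [modular_T_smul]
  simp [add_comm]

theorem S_smul_S_smul (τ : ℍ) : S • S • τ = τ := by
  have := τ.ne_zero
  apply UpperHalfPlane.ext
  rw [coe_S_smul, coe_S_smul]
  field_simp

theorem coe_T_inv_smul (τ : ℍ) : ((T⁻¹ • τ : ℍ) : ℂ) = τ - 1 := by
  have := coe_T_smul (T⁻¹ • τ)
  rw [smul_inv_smul] at this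
  rw [this]
  ring

theorem T_smul_S_smul_T_smul (τ : ℍ) : T • S • T • τ = S • T⁻¹ • S • τ := by
  have h1 := τ.ne_zero
  have h2 : (τ : ℂ) + 1 ≠ 0 := by
    rw [← coe_T_smul]; exact (T • τ).ne_zero
  have h3 := (T⁻¹ • S • τ).ne_zero
  rw [coe_T_inv_smul, coe_S_smul] at h3
  apply UpperHalfPlane.ext
  rw [coe_T_smul, coe_S_smul, coe_S_smul, coe_T_smul, coe_T_inv_smul, coe_S_smul]
  rw [show (-1 / (τ : ℂ) - 1) = -((τ + 1) / τ) by field_simp; ring]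
  field_simp
  ring

theorem tendsto_T_smul_atImInfty : Tendsto (fun τ : ℍ => T • τ) atImInfty atImInfty := by
  simp only [atImInfty, tendsto_comap_iff]
  refine Tendsto.congr (f₁ := UpperHalfPlane.im) (fun τ => ?_) tendsto_comap
  simp only [Function.comp_apply]
  exact (im_T_smul τ).symm

theorem slash_S_eq (f : ℍ → ℂ) (k : ℤ) (τ : ℍ) : (f ∣[k] S) τ = f (S • τ) * (τ : ℂ) ^ (-k) := by
  rw [SlashInvariantForm.slash_S_apply, modular_S_smul]

theorem slash_T_eq (f : ℍ → ℂ) (k : ℤ) (τ : ℍ) : (f ∣[k] T) τ = f (T • τ) := by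
  have h : denom (T : GL (Fin 2) ℝ) τ = 1 := by
    have h0 : (((T : SL(2, ℤ)) : GL (Fin 2) ℝ) 1 0) = ((T 1 0 : ℤ) : ℝ) := rfl
    have h1 : (((T : SL(2, ℤ)) : GL (Fin 2) ℝ) 1 1) = ((T 1 1 : ℤ) : ℝ) := rfl
    rw [denom, h0, h1]
    simp [coe_T]
  rw [SL_slash_apply, h, one_zpow, mul_one]

theorem discriminant_T_smul (τ : ℍ) : ModularForm.discriminant (T • τ) = ModularForm.discriminant τ := by
  rw [← slash_T_eq ModularForm.discriminant 12, discriminant_T_invariant]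

theorem discriminant_S_smul (τ : ℍ) :
    ModularForm.discriminant (S • τ) = (τ : ℂ) ^ 12 * ModularForm.discriminant τ := by
  have h := congrFun discriminant_S_invariant τ
  rw [slash_S_eq] at h
  have hτ := τ.ne_zero
  rw [← h, zpow_neg]
  field_simp

/-- A holomorphic function of weight `108` and level one vanishing to order more than `9` at the
cusp is zero. -/
theorem eq_zero_of_weight_108 {P : ℍ → ℂ} (hP : MDiff P)
    (hS : ∀ τ : ℍ, P (S • τ) = (τ : ℂ) ^ 108 * P τ) (hT : ∀ τ : ℍ, P (T • τ) = P τ)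
    {c : ℝ} (hc : 18 < c)
    (hO : P =O[atImInfty] fun τ => Real.exp (-(Real.pi * c) * τ.im)) : P = 0 := by
  let Q : ℍ → ℂ := fun τ => P τ / ModularForm.discriminant τ ^ 9
  have hinv : ∀ γ : SL(2, ℤ), Q ∣[(0 : ℤ)] γ = Q := by
    refine SlashInvariantForm.slash_action_generators_SL2Z (funext fun τ => ?_) (funext fun τ => ?_)
    · have := τ.ne_zero
      rw [slash_S_eq]
      simp only [Q, hS, discriminant_S_smul]
      have := discriminant_ne_zero τ
      field_simp
      simp
    · rw [slash_T_eq]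
      simp only [Q, hT, discriminant_T_smul]
  have hlim : Tendsto Q atImInfty (𝓝 0) := by
    have h1 : Q =O[atImInfty] fun τ => Real.exp (-(Real.pi * (c - 18)) * τ.im) := by
      have h2 := hO.mul ((exp_isBigO_discriminant.pow 9).inv_rev (.of_forall fun τ h => ?_))
      · refine h2.congr (fun τ => rfl) fun τ => ?_
        rw [← Real.exp_nat_mul, ← Real.exp_neg, ← Real.exp_add]
        congr 1
        push_cast
        ring
      · exact absurd h (pow_ne_zero _ (Real.exp_ne_zero _))
    refine h1.trans_tendsto ?_
    refine Real.tendsto_exp_atBot.comp ?_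
    have : Tendsto UpperHalfPlane.im atImInfty atTop := tendsto_comap
    refine this.const_mul_atTop_of_neg ?_
    have := Real.pi_pos
    nlinarith
  let f : ModularForm 𝒮ℒ 0 :=
    { toFun := Q
      slash_action_eq' := fun _ ⟨γ, hγ⟩ => hγ ▸ hinv γ
      holo' := hP.div (CuspForm.discriminant.holo'.pow 9) fun τ =>
        pow_ne_zero _ (discriminant_ne_zero τ)
      bdd_at_cusps' := by
        intro c hc
        rw [Subgroup.IsArithmetic.isCusp_iff_isCusp_SL2Z] at hc
        rw [isBoundedAt_iff_forall_SL2Z hc]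
        intro γ _
        rw [hinv γ]
        exact hlim.isBigO_one ℝ }
  obtain ⟨a, ha⟩ := ModularFormClass.levelOne_weight_zero_const f
  have ha' : Q = Function.const _ a := ha
  have ha0 : a = 0 := by
    rw [ha'] at hlim
    exact tendsto_nhds_unique tendsto_const_nhds hlim
  funext τ
  have h := congrFun ha' τ
  simp only [Q, Function.const_apply, ha0, div_eq_zero_iff] at h
  exact h.resolve_right (pow_ne_zero _ (discriminant_ne_zero τ))

theorem eq_zero_or_eq_zero_of_mdiff {f g : ℍ → ℂ} (hf : MDiff f) (hg : MDiff g)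
    (h : ∀ τ, f τ * g τ = 0) : (∀ τ, f τ = 0) ∨ ∀ τ, g τ = 0 := by
  rw [mdifferentiable_iff] at hf hg
  have hopen : IsOpen {z : ℂ | 0 < z.im} := isOpen_lt continuous_const Complex.continuous_im
  have hconn : IsPreconnected {z : ℂ | 0 < z.im} := (convex_halfSpace_im_gt 0).isPreconnected
  rcases AnalyticOnNhd.eq_zero_or_eq_zero_of_mul_eq_zero (hf.analyticOnNhd hopen)
    (hg.analyticOnNhd hopen) (fun z hz => h _) hconn with h | h
  · refine .inl fun τ => ?_
    simpa using h τ τ.im_pos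
  · refine .inr fun τ => ?_
    simpa using h τ τ.im_pos

theorem eq_zero_of_weight_eighteen {F : ℍ → ℂ} (hF : MDiff F)
    (hS : ∀ τ : ℍ, F (S • τ) = -(τ : ℂ) ^ 18 * F τ) (hT : ∀ τ : ℍ, F (T • T • τ) = F τ)
    (h1 : F =O[atImInfty] fun τ => Real.exp (-(Real.pi * 4) * τ.im))
    (h2 : (fun τ : ℍ => F (T • S • τ) * ((τ : ℂ) ^ 18)⁻¹) =O[atImInfty]
      fun τ => Real.exp (-(Real.pi * (5 / 4)) * τ.im)) : ∀ τ, F τ = 0 := by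
  let G : ℍ → ℂ := fun τ => F (T • τ)
  let H : ℍ → ℂ := fun τ => F (T • S • τ) * ((τ : ℂ) ^ 18)⁻¹
  have hGs : G = F ∣[(18 : ℤ)] T := funext fun τ => (slash_T_eq F 18 τ).symm
  have hHs : H = G ∣[(18 : ℤ)] S := funext fun τ => by
    rw [slash_S_eq, zpow_neg]
    rfl
  have hG : MDiff G := hGs ▸ hF.slash 18 _
  have hH : MDiff H := hHs ▸ hG.slash 18 _
  have hGO : G =O[atImInfty] fun τ => Real.exp (-(Real.pi * 4) * τ.im) :=
    (h1.comp_tendsto tendsto_T_smul_atImInfty).congr (fun _ => rfl) fun τ => by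
      simp only [Function.comp_apply, im_T_smul]
  have hHT : ∀ τ : ℍ, H (T • τ) = -H τ := by
    intro τ
    have hτ := τ.ne_zero
    have hτ1 : (τ : ℂ) + 1 ≠ 0 := by
      rw [← coe_T_smul]; exact (T • τ).ne_zero
    have h3 : F (T⁻¹ • S • τ) = F (T • S • τ) := by
      rw [← hT (T⁻¹ • S • τ), smul_inv_smul]
    simp only [H]
    rw [T_smul_S_smul_T_smul, hS, h3, coe_T_inv_smul, coe_S_smul, coe_T_smul]
    rw [show (-1 / (τ : ℂ) - 1) = -((τ + 1) / τ) by field_simp; ring]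
    field_simp
  have hHS : ∀ τ : ℍ, H (S • τ) = (τ : ℂ) ^ 18 * G τ := by
    intro τ
    have hτ := τ.ne_zero
    simp only [H, G]
    rw [S_smul_S_smul, coe_S_smul]
    field_simp
  have hGS : ∀ τ : ℍ, G (S • τ) = (τ : ℂ) ^ 18 * H τ := by
    intro τ
    have hτ := τ.ne_zero
    simp only [H, G]
    field_simp
  have hGT : ∀ τ : ℍ, G (T • τ) = F τ := hT
  have hP : (fun τ => (F τ * G τ * H τ) ^ 2) = 0 := by
    refine eq_zero_of_weight_108 (c := 37 / 2) (((hF.mul hG).mul hH).pow 2) (fun τ => ?_)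
      (fun τ => ?_) (by norm_num) ?_
    · rw [hS, hGS, hHS]
      ring
    · rw [hGT, hHT]
      simp only [G]
      ring
    · refine (((h1.mul hGO).mul h2).pow 2).congr (fun _ => rfl) fun τ => ?_
      rw [← Real.exp_add, ← Real.exp_add, ← Real.exp_nat_mul]
      congr 1
      push_cast
      ring
  have hP' : ∀ τ, F τ * G τ * H τ = 0 := fun τ => by
    simpa using congrFun hP τ
  rcases eq_zero_or_eq_zero_of_mdiff (hF.mul hG) hH hP' with h | h
  · rcases eq_zero_or_eq_zero_of_mdiff hF hG h with h | h
    · exact h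
    · intro τ
      rw [← smul_inv_smul T τ]
      exact h _
  · intro τ
    have := h (S • T⁻¹ • τ)
    rw [hHS] at this
    simp only [G, smul_inv_smul] at this
    exact (mul_eq_zero.mp this).resolve_left (pow_ne_zero _ (T⁻¹ • τ).ne_zero)

end ModularVanishing

section NomeExpansion

open UpperHalfPlane ModularForm ModularGroup MatrixGroups Filter Asymptotics
open scoped Topology Manifold

theorem mdifferentiable_thetaSeries {X : Type*} {N : X → ℝ} (hN : ∀ x, 0 ≤ N x)
    (hs : ∀ a : ℝ, 0 < a → Summable fun x => Real.exp (-a * N x)) :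
    MDiff (fun τ : ℍ => thetaSeries N τ) := by
  rw [mdifferentiable_iff]
  have key : DifferentiableOn ℂ (thetaSeries N) {z : ℂ | 0 < z.im} := by
    intro z hz
    have hz' : 0 < z.im := hz
    have hopen : IsOpen {w : ℂ | z.im / 2 < w.im} := isOpen_lt continuous_const Complex.continuous_im
    have hd : DifferentiableOn ℂ (thetaSeries N) {w : ℂ | z.im / 2 < w.im} := by
      refine Complex.differentiableOn_tsum_of_summable_norm
        (u := fun x => Real.exp (-(Real.pi * (z.im / 2)) * N x))
        (hs _ (by have := Real.pi_pos; positivity)) (fun x => ?_) hopen fun x w hw => ?_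
      · fun_prop
      · rw [norm_cexp_pi_I_mul]
        have hw' : z.im / 2 < w.im := hw
        refine Real.exp_le_exp.mpr (mul_le_mul_of_nonneg_right ?_ (hN x))
        have := mul_le_mul_of_nonneg_left hw'.le Real.pi_pos.le
        linarith
    exact (hd.differentiableAt
      (hopen.mem_nhds (show z.im / 2 < z.im by linarith))).differentiableWithinAt
  refine key.congr fun z hz => ?_
  simp [ofComplex_apply_of_im_pos (show 0 < z.im from hz)]

theorem isBigO_thetaSeries_sub_sum {X : Type*} {N : X → ℝ} {c : ℝ} (s : Finset X)
    (hN : ∀ x ∉ s, c ≤ N x) (hs : ∀ a : ℝ, 0 < a → Summable fun x => Real.exp (-a * N x)) :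
    (fun τ : ℍ => thetaSeries N τ - ∑ x ∈ s, Complex.exp (Real.pi * Complex.I * τ * N x))
      =O[atImInfty] fun τ => Real.exp (-(Real.pi * c) * τ.im) := by
  have hpi := Real.pi_pos
  have hsub := (hs Real.pi hpi).subtype (s : Set X)ᶜ
  refine IsBigO.of_bound
    (Real.exp (Real.pi * c) * ∑' x : ((s : Set X)ᶜ : Set X), Real.exp (-Real.pi * N x)) ?_
  have hev : ∀ᶠ τ : ℍ in atImInfty, 1 ≤ τ.im := tendsto_comap.eventually_ge_atTop 1
  filter_upwards [hev] with τ hτ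
  have hnorm : Summable fun x => ‖Complex.exp (Real.pi * Complex.I * (τ : ℂ) * N x)‖ := by
    simp only [norm_cexp_pi_I_mul]
    exact hs _ (mul_pos hpi τ.im_pos)
  have hsplit := hnorm.of_norm.sum_add_tsum_compl (s := s)
  rw [thetaSeries, ← hsplit, add_sub_cancel_left]
  refine (norm_tsum_le_tsum_norm (hnorm.subtype _)).trans ?_
  rw [Real.norm_of_nonneg (Real.exp_pos _).le, mul_right_comm (Real.exp (Real.pi * c)),
    ← tsum_mul_left]
  refine (hnorm.subtype _).tsum_le_tsum (fun x => ?_) (hsub.mul_left _)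
  simp only [norm_cexp_pi_I_mul, coe_im]
  rw [← Real.exp_add, ← Real.exp_add]
  refine Real.exp_le_exp.mpr ?_
  have h := mul_le_mul_of_nonneg_left (hN x x.2) (mul_nonneg hpi.le (sub_nonneg.mpr hτ))
  linarith

/-- The nome `exp(π i τ)`. -/
noncomputable def nome (τ : ℍ) : ℂ := Complex.exp (Real.pi * Complex.I * τ)

theorem norm_nome_pow (τ : ℍ) (k : ℕ) :
    ‖nome τ ^ k‖ = Real.exp (-(Real.pi * k) * τ.im) := by
  have h := norm_cexp_pi_I_mul τ 1
  rw [Complex.ofReal_one, mul_one, coe_im] at h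
  rw [norm_pow, nome, h, ← Real.exp_nat_mul]
  congr 1
  ring

theorem cexp_eq_nome_pow (τ : ℍ) (k : ℕ) :
    Complex.exp (Real.pi * Complex.I * τ * (k : ℝ)) = nome τ ^ k := by
  rw [nome, ← Complex.exp_nat_mul]
  congr 1
  push_cast
  ring

theorem nome_T_smul (τ : ℍ) : nome (T • τ) = -nome τ := by
  rw [nome, nome, coe_T_smul, mul_add, mul_one, Complex.exp_add, Complex.exp_pi_mul_I]
  ring

theorem isBigO_nome_pow (k : ℕ) :
    (fun τ => nome τ ^ k) =O[atImInfty] fun τ => Real.exp (-(Real.pi * k) * τ.im) :=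
  IsBigO.of_bound 1 (.of_forall fun τ => by
    rw [norm_nome_pow, Real.norm_of_nonneg (Real.exp_pos _).le, one_mul])

theorem isBigO_exp_im {a b : ℝ} (h : b ≤ a) :
    (fun τ : ℍ => Real.exp (-(Real.pi * a) * τ.im)) =O[atImInfty]
      fun τ => Real.exp (-(Real.pi * b) * τ.im) :=
  IsBigO.of_bound 1 (.of_forall fun τ => by
    rw [Real.norm_of_nonneg (Real.exp_pos _).le, Real.norm_of_nonneg (Real.exp_pos _).le, one_mul]
    have := mul_le_mul_of_nonneg_right (mul_le_mul_of_nonneg_left h Real.pi_pos.le) τ.im_pos.le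
    exact Real.exp_le_exp.mpr (by linarith))

theorem tendsto_exp_im {c : ℝ} (hc : 0 < c) :
    Tendsto (fun τ : ℍ => Real.exp (-(Real.pi * c) * τ.im)) atImInfty (𝓝 0) := by
  refine Real.tendsto_exp_atBot.comp ?_
  have : Tendsto UpperHalfPlane.im atImInfty atTop := tendsto_comap
  exact this.const_mul_atTop_of_neg (neg_lt_zero.mpr (mul_pos Real.pi_pos hc))

/-- `f = a₀ + a₁ p + a₂ p² + a₃ p³ + a₄ p⁴ + O(p⁵)` at the cusp, where `p = exp(π i τ)`. -/
def HasNomeExpansion (f : ℍ → ℂ) (a₀ a₁ a₂ a₃ a₄ : ℂ) : Prop :=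
  (fun τ => f τ - (a₀ + a₁ * nome τ + a₂ * nome τ ^ 2 + a₃ * nome τ ^ 3 + a₄ * nome τ ^ 4))
    =O[atImInfty] fun τ => Real.exp (-(Real.pi * 5) * τ.im)

namespace HasNomeExpansion

variable {f g : ℍ → ℂ} {a₀ a₁ a₂ a₃ a₄ b₀ b₁ b₂ b₃ b₄ : ℂ}

theorem const (c : ℂ) : HasNomeExpansion (fun _ => c) c 0 0 0 0 := by
  refine (isBigO_zero _ _).congr (fun τ => ?_) fun τ => rfl
  ring

theorem add (hf : HasNomeExpansion f a₀ a₁ a₂ a₃ a₄) (hg : HasNomeExpansion g b₀ b₁ b₂ b₃ b₄) :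
    HasNomeExpansion (fun τ => f τ + g τ) (a₀ + b₀) (a₁ + b₁) (a₂ + b₂) (a₃ + b₃) (a₄ + b₄) := by
  refine (IsBigO.add hf hg).congr (fun τ => ?_) fun τ => rfl
  ring

theorem const_mul (c : ℂ) (hf : HasNomeExpansion f a₀ a₁ a₂ a₃ a₄) :
    HasNomeExpansion (fun τ => c * f τ) (c * a₀) (c * a₁) (c * a₂) (c * a₃) (c * a₄) := by
  refine (IsBigO.const_mul_left hf c).congr (fun τ => ?_) fun τ => rfl
  ring

theorem sub (hf : HasNomeExpansion f a₀ a₁ a₂ a₃ a₄) (hg : HasNomeExpansion g b₀ b₁ b₂ b₃ b₄) :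
    HasNomeExpansion (fun τ => f τ - g τ) (a₀ - b₀) (a₁ - b₁) (a₂ - b₂) (a₃ - b₃) (a₄ - b₄) := by
  refine (IsBigO.sub hf hg).congr (fun τ => ?_) fun τ => rfl
  ring

theorem isBigO_one_const_mul_nome_pow (c : ℂ) (k : ℕ) :
    (fun τ => c * nome τ ^ k) =O[atImInfty] fun _ => (1 : ℝ) := by
  refine ((isBigO_nome_pow k).const_mul_left c).trans ?_
  refine (isBigO_exp_im (a := k) (b := 0) (Nat.cast_nonneg k)).congr (fun _ => rfl) fun τ => ?_
  simp

theorem isBigO_one_poly (a₀ a₁ a₂ a₃ a₄ : ℂ) :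
    (fun τ => a₀ + a₁ * nome τ + a₂ * nome τ ^ 2 + a₃ * nome τ ^ 3 + a₄ * nome τ ^ 4)
      =O[atImInfty] fun _ => (1 : ℝ) :=
  (((((isBigO_one_const_mul_nome_pow a₀ 0).add (isBigO_one_const_mul_nome_pow a₁ 1)).add
    (isBigO_one_const_mul_nome_pow a₂ 2)).add (isBigO_one_const_mul_nome_pow a₃ 3)).add
    (isBigO_one_const_mul_nome_pow a₄ 4)).congr (fun τ => by ring) fun _ => rfl

theorem isBigO_one (hf : HasNomeExpansion f a₀ a₁ a₂ a₃ a₄) :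
    f =O[atImInfty] fun _ => (1 : ℝ) := by
  have h : (fun τ => f τ - (a₀ + a₁ * nome τ + a₂ * nome τ ^ 2 + a₃ * nome τ ^ 3 + a₄ * nome τ ^ 4))
      =O[atImInfty] fun _ => (1 : ℝ) :=
    IsBigO.trans hf ((isBigO_exp_im (a := 5) (b := 0) (by norm_num)).congr (fun _ => rfl)
      fun τ => by simp)
  exact (h.add (isBigO_one_poly a₀ a₁ a₂ a₃ a₄)).congr (fun τ => by ring) fun _ => rfl

theorem mul (hf : HasNomeExpansion f a₀ a₁ a₂ a₃ a₄) (hg : HasNomeExpansion g b₀ b₁ b₂ b₃ b₄) :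
    HasNomeExpansion (fun τ => f τ * g τ) (a₀ * b₀) (a₀ * b₁ + a₁ * b₀)
      (a₀ * b₂ + a₁ * b₁ + a₂ * b₀) (a₀ * b₃ + a₁ * b₂ + a₂ * b₁ + a₃ * b₀)
      (a₀ * b₄ + a₁ * b₃ + a₂ * b₂ + a₃ * b₁ + a₄ * b₀) := by
  have h1 := IsBigO.mul hf hg.isBigO_one
  have h2 := (isBigO_one_poly a₀ a₁ a₂ a₃ a₄).mul hg
  have h3 := (isBigO_nome_pow 5).mul (isBigO_one_poly
    (a₁ * b₄ + a₂ * b₃ + a₃ * b₂ + a₄ * b₁) (a₂ * b₄ + a₃ * b₃ + a₄ * b₂) (a₃ * b₄ + a₄ * b₃)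
    (a₄ * b₄) 0)
  simp only [mul_one, one_mul, Nat.cast_ofNat] at h1 h2 h3
  refine ((h1.add h2).add h3).congr (fun τ => ?_) fun τ => rfl
  ring

theorem comp_T_smul (hf : HasNomeExpansion f a₀ a₁ a₂ a₃ a₄) :
    HasNomeExpansion (fun τ => f (T • τ)) a₀ (-a₁) a₂ (-a₃) a₄ := by
  refine (hf.comp_tendsto tendsto_T_smul_atImInfty).congr (fun τ => ?_) fun τ => ?_
  · simp only [Function.comp_apply, nome_T_smul]
    ring
  · simp only [Function.comp_apply, ModularGroup.im_T_smul]

theorem congr_left (hf : HasNomeExpansion f a₀ a₁ a₂ a₃ a₄) (h : ∀ τ, f τ = g τ) :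
    HasNomeExpansion g a₀ a₁ a₂ a₃ a₄ :=
  (funext h : f = g) ▸ hf

theorem congr_coeff (hf : HasNomeExpansion f a₀ a₁ a₂ a₃ a₄) (b₀ b₁ b₂ b₃ b₄ : ℂ)
    (h : a₀ = b₀ ∧ a₁ = b₁ ∧ a₂ = b₂ ∧ a₃ = b₃ ∧ a₄ = b₄) : HasNomeExpansion f b₀ b₁ b₂ b₃ b₄ := by
  obtain ⟨rfl, rfl, rfl, rfl, rfl⟩ := h
  exact hf

theorem eq_zero_of_zero (h : HasNomeExpansion (fun _ => 0) 0 0 0 0 a₄) : a₄ = 0 := by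
  have h1 := IsBigO.mul h (isBigO_refl (fun τ : ℍ => (nome τ ^ 4)⁻¹) atImInfty).norm_right
  have h2 : (fun τ : ℍ => Real.exp (-(Real.pi * 5) * τ.im) * ‖(nome τ ^ 4)⁻¹‖) =
      fun τ => Real.exp (-(Real.pi * 1) * τ.im) := funext fun τ => by
    rw [norm_inv, norm_nome_pow, ← Real.exp_neg, ← Real.exp_add]
    congr 1
    push_cast
    ring
  rw [h2] at h1
  have h4 := h1.trans_tendsto (tendsto_exp_im one_pos)
  have h5 := tendsto_nhds_unique (h4.congr fun τ => show _ = -a₄ by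
    have : nome τ ≠ 0 := Complex.exp_ne_zero _
    field_simp
    ring) tendsto_const_nhds
  exact neg_eq_zero.mp h5.symm

end HasNomeExpansion

end NomeExpansion

section ThetaConstants

open UpperHalfPlane ModularForm ModularGroup MatrixGroups Filter Asymptotics
open scoped Topology Manifold

/-- The fourth power of the Jacobi theta constant `ϑ₃`. -/
noncomputable def thetaThreePow (τ : ℍ) : ℂ := jacobiTheta τ ^ 4

/-- The fourth power of the Jacobi theta constant `ϑ₄`. -/
noncomputable def thetaFourPow (τ : ℍ) : ℂ := thetaThreePow (T • τ)

/-- The fourth power of the Jacobi theta constant `ϑ₂`. -/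
noncomputable def thetaTwoPow (τ : ℍ) : ℂ := -((τ : ℂ) ^ 2)⁻¹ * thetaFourPow (S • τ)

theorem thetaThreePow_S_smul (τ : ℍ) :
    thetaThreePow (S • τ) = -(τ : ℂ) ^ 2 * thetaThreePow τ := by
  rw [thetaThreePow, thetaThreePow, jacobiTheta_S_smul, mul_pow, ← Complex.cpow_nat_mul]
  norm_num [mul_pow]

theorem thetaThreePow_T_smul (τ : ℍ) : thetaThreePow (T • τ) = thetaFourPow τ := rfl

theorem thetaFourPow_T_smul (τ : ℍ) : thetaFourPow (T • τ) = thetaThreePow τ := by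
  rw [thetaFourPow, thetaThreePow, thetaThreePow, coe_T_smul, coe_T_smul, add_assoc,
    one_add_one_eq_two, add_comm, jacobiTheta_two_add]

theorem thetaFourPow_S_smul (τ : ℍ) : thetaFourPow (S • τ) = -(τ : ℂ) ^ 2 * thetaTwoPow τ := by
  have := τ.ne_zero
  rw [thetaTwoPow]
  field_simp

theorem thetaTwoPow_S_smul (τ : ℍ) : thetaTwoPow (S • τ) = -(τ : ℂ) ^ 2 * thetaFourPow τ := by
  have := τ.ne_zero
  rw [thetaTwoPow, S_smul_S_smul, coe_S_smul]
  field_simp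

theorem thetaTwoPow_T_smul (τ : ℍ) : thetaTwoPow (T • τ) = -thetaTwoPow τ := by
  have hτ := τ.ne_zero
  have hτ1 : (τ : ℂ) + 1 ≠ 0 := by
    rw [← coe_T_smul]; exact (T • τ).ne_zero
  have h : thetaThreePow (T⁻¹ • S • τ) = thetaFourPow (S • τ) := by
    rw [← thetaFourPow_T_smul, smul_inv_smul]
  rw [thetaTwoPow, thetaTwoPow, thetaFourPow, T_smul_S_smul_T_smul, thetaThreePow_S_smul, h,
    coe_T_inv_smul, coe_S_smul, coe_T_smul,
    show (-1 / (τ : ℂ) - 1) = -((τ + 1) / τ) by field_simp; ring]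
  field_simp

theorem mdifferentiable_thetaThreePow : MDiff thetaThreePow := by
  rw [mdifferentiable_iff]
  refine DifferentiableOn.congr (f := fun z => jacobiTheta z ^ 4)
    (fun z hz => ((differentiableAt_jacobiTheta hz).pow 4).differentiableWithinAt) fun z hz => ?_
  simp [thetaThreePow, ofComplex_apply_of_im_pos (show 0 < z.im from hz)]

theorem mdifferentiable_thetaFourPow : MDiff thetaFourPow := by
  have h : thetaFourPow = thetaThreePow ∣[(2 : ℤ)] T :=
    funext fun τ => (slash_T_eq thetaThreePow 2 τ).symm
  exact h ▸ mdifferentiable_thetaThreePow.slash 2 _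

theorem mdifferentiable_thetaTwoPow : MDiff thetaTwoPow := by
  have h : thetaTwoPow = -(thetaFourPow ∣[(2 : ℤ)] S) := funext fun τ => by
    rw [Pi.neg_apply, slash_S_eq, thetaTwoPow, zpow_neg, neg_mul, mul_comm]
    rfl
  exact h ▸ (mdifferentiable_thetaFourPow.slash 2 _).neg

theorem summable_exp_neg_mul_int {N : ℤ → ℝ} (hN : ∀ n : ℤ, |(n : ℝ)| - 1 ≤ N n) {a : ℝ}
    (ha : 0 < a) : Summable fun n => Real.exp (-a * N n) := by
  have h : Summable fun n : ℤ => Real.exp a * Real.exp (-a * |(n : ℝ)|) := by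
    refine Summable.mul_left _ (Summable.of_nat_of_neg ?_ ?_)
    · simpa [mul_comm] using Real.summable_exp_nat_mul_iff.mpr (neg_lt_zero.mpr ha)
    · simpa [mul_comm] using Real.summable_exp_nat_mul_iff.mpr (neg_lt_zero.mpr ha)
  refine h.of_nonneg_of_le (fun n => (Real.exp_pos _).le) fun n => ?_
  rw [← Real.exp_add]
  refine Real.exp_le_exp.mpr ?_
  nlinarith [hN n]

theorem jacobiTheta_eq_thetaSeries (τ : ℂ) :
    jacobiTheta τ = thetaSeries (fun n : ℤ => ((n ^ 2 : ℤ) : ℝ)) τ :=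
  tsum_congr fun n => by
    push_cast
    congr 1
    ring

theorem hasNomeExpansion_jacobiTheta :
    HasNomeExpansion (fun τ => jacobiTheta τ) 1 2 0 0 2 := by
  have h := isBigO_thetaSeries_sub_sum (N := fun n : ℤ => ((n ^ 2 : ℤ) : ℝ)) (c := 5)
    (Finset.Icc (-2) 2) (fun n hn => ?_) fun a ha => summable_exp_neg_mul_int (fun n => ?_) ha
  · refine h.congr (fun τ => ?_) fun τ => rfl
    have e : Finset.Icc (-2 : ℤ) 2 = {-2, -1, 0, 1, 2} := by decide
    simp only [jacobiTheta_eq_thetaSeries]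
    rw [e]
    have e0 := cexp_eq_nome_pow τ 0
    have e1 := cexp_eq_nome_pow τ 1
    have e4 := cexp_eq_nome_pow τ 4
    norm_num at e0 e1 e4 ⊢
    rw [e1, e4]
    ring
  · rw [Finset.mem_Icc, not_and_or] at hn
    have : (5 : ℤ) ≤ n ^ 2 := by rcases hn with hn | hn <;> nlinarith
    exact_mod_cast this
  · push_cast
    rw [← sq_abs (n : ℝ)]
    nlinarith [sq_nonneg (|(n : ℝ)| - 1), abs_nonneg (n : ℝ)]

theorem thetaTwoPow_eq (τ : ℍ) :
    thetaTwoPow τ = nome τ * thetaSeries (fun n : ℤ => ((n ^ 2 - n : ℤ) : ℝ)) τ ^ 4 := by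
  have hτ := τ.ne_zero
  have h := jacobiTheta₂_functional_equation (1 / 2) (-1 / τ)
  have h1 : jacobiTheta (T • S • τ : ℍ) = jacobiTheta₂ (1 / 2) (-1 / τ) := by
    rw [coe_T_smul, coe_S_smul, jacobiTheta, jacobiTheta₂]
    refine tsum_congr fun n => ?_
    rw [jacobiTheta₂_term]
    obtain ⟨m, hm⟩ : ∃ m : ℤ, n ^ 2 = n + 2 * m := by
      obtain ⟨m, hm⟩ := Int.even_mul_pred_self n
      exact ⟨m, by linear_combination hm⟩
    refine Complex.exp_eq_exp_iff_exists_int.mpr ⟨m, ?_⟩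
    have hm' : (n : ℂ) ^ 2 = n + 2 * m := by exact_mod_cast hm
    linear_combination (Real.pi * Complex.I : ℂ) * hm'
  have h2 : jacobiTheta₂ (1 / 2 / (-1 / τ)) (-1 / (-1 / (τ : ℂ))) =
      thetaSeries (fun n : ℤ => ((n ^ 2 - n : ℤ) : ℝ)) τ := by
    refine tsum_congr fun n => ?_
    rw [jacobiTheta₂_term]
    congr 1
    push_cast
    field_simp
    ring
  have h3 : ((-Complex.I * (-1 / (τ : ℂ))) ^ (1 / 2 : ℂ)) ^ 4 = -((τ : ℂ) ^ 2)⁻¹ := by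
    rw [← Complex.cpow_nat_mul]
    norm_num [div_pow, mul_pow]
  have h4 : Complex.exp (-Real.pi * Complex.I * (1 / 2) ^ 2 / (-1 / (τ : ℂ))) ^ 4 = nome τ := by
    rw [← Complex.exp_nat_mul, nome]
    congr 1
    push_cast
    field_simp
    norm_num
  rw [thetaTwoPow, thetaFourPow, thetaThreePow, h1, h, h2, mul_pow, mul_pow, h4, div_pow, h3]
  field_simp

theorem hasNomeExpansion_thetaSeries_sq_sub :
    HasNomeExpansion (fun τ => thetaSeries (fun n : ℤ => ((n ^ 2 - n : ℤ) : ℝ)) τ) 2 0 2 0 0 := by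
  have h := isBigO_thetaSeries_sub_sum (N := fun n : ℤ => ((n ^ 2 - n : ℤ) : ℝ)) (c := 5)
    (Finset.Icc (-1) 2) (fun n hn => ?_) fun a ha => summable_exp_neg_mul_int (fun n => ?_) ha
  · refine h.congr (fun τ => ?_) fun τ => rfl
    have e : Finset.Icc (-1 : ℤ) 2 = {-1, 0, 1, 2} := by decide
    rw [e]
    have e0 := cexp_eq_nome_pow τ 0
    have e2 := cexp_eq_nome_pow τ 2
    norm_num at e0 e2 ⊢
    rw [e2]
    ring
  · rw [Finset.mem_Icc, not_and_or] at hn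
    have : (5 : ℤ) ≤ n ^ 2 - n := by rcases hn with hn | hn <;> nlinarith
    exact_mod_cast this
  · push_cast
    have h1 := neg_abs_le (n : ℝ)
    have h2 := le_abs_self (n : ℝ)
    rw [← sq_abs (n : ℝ)]
    nlinarith [sq_nonneg (|(n : ℝ)| - 1), abs_nonneg (n : ℝ)]

theorem hasNomeExpansion_nome : HasNomeExpansion nome 0 1 0 0 0 := by
  refine (isBigO_zero _ _).congr (fun τ => ?_) fun τ => rfl
  ring

theorem hasNomeExpansion_thetaThreePow : HasNomeExpansion thetaThreePow 1 8 24 32 24 := by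
  have h2 := hasNomeExpansion_jacobiTheta.mul hasNomeExpansion_jacobiTheta
  have h4 := (h2.mul h2).congr_left (g := thetaThreePow) fun τ => by rw [thetaThreePow]; ring
  convert h4 using 1 <;> norm_num

theorem hasNomeExpansion_thetaFourPow : HasNomeExpansion thetaFourPow 1 (-8) 24 (-32) 24 :=
  hasNomeExpansion_thetaThreePow.comp_T_smul

theorem hasNomeExpansion_thetaTwoPow : HasNomeExpansion thetaTwoPow 0 16 0 64 0 := by
  have h2 := hasNomeExpansion_thetaSeries_sq_sub.mul hasNomeExpansion_thetaSeries_sq_sub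
  have h4 := (hasNomeExpansion_nome.mul (h2.mul h2)).congr_left (g := thetaTwoPow) fun τ => by
    rw [thetaTwoPow_eq]; ring
  convert h4 using 1 <;> norm_num

end ThetaConstants

section Extremal

open UpperHalfPlane ModularForm ModularGroup MatrixGroups Filter Asymptotics
open scoped Topology Manifold

section Coefficients

variable {X : Type*} {N : X → ℝ}

theorem finite_setOf_eq_of_summable (hs : Summable fun x => Real.exp (-1 * N x)) (r : ℝ) :
    {x | N x = r}.Finite := by
  have h := hs.tendsto_cofinite_zero.eventually_lt_const (Real.exp_pos (-1 * r))
  rw [eventually_cofinite] at h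
  refine h.subset fun x hx => ?_
  have hx' : N x = r := hx
  exact fun h' => (hx' ▸ h').ne rfl

theorem sum_cexp_toFinset {k : ℕ} (hf : {x | N x = k}.Finite) (τ : ℍ) :
    ∑ x ∈ hf.toFinset, Complex.exp (Real.pi * Complex.I * τ * N x) =
      {x | N x = k}.ncard * nome τ ^ k := by
  rw [Set.ncard_eq_toFinset_card _ hf, ← nsmul_eq_mul, ← Finset.sum_const]
  refine Finset.sum_congr rfl fun x hx => ?_
  have hx' : N x = k := by simpa using hx
  rw [hx', cexp_eq_nome_pow]

theorem ncard_mul_exp_le_re_thetaSeries (hs : ∀ a : ℝ, 0 < a → Summable fun x => Real.exp (-a * N x))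
    (k : ℕ) {τ : ℍ} (hτ : τ.re = 0) :
    {x | N x = k}.ncard * Real.exp (-(Real.pi * k) * τ.im) ≤ (thetaSeries N τ).re := by
  have hf := finite_setOf_eq_of_summable (hs 1 one_pos) k
  have hsum := hs _ (mul_pos Real.pi_pos τ.im_pos)
  have e : thetaSeries N τ = ((∑' x, Real.exp (-(Real.pi * τ.im) * N x) : ℝ) : ℂ) := by
    rw [thetaSeries, Complex.ofReal_tsum]
    refine tsum_congr fun x => ?_
    have hz : (τ : ℂ) = τ.im * Complex.I := by
      apply Complex.ext <;> simp [hτ]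
    rw [hz, Complex.ofReal_exp]
    congr 1
    push_cast
    linear_combination (Real.pi * τ.im * N x : ℂ) * Complex.I_mul_I
  rw [e, Complex.ofReal_re]
  refine le_trans (le_of_eq ?_) (hsum.sum_le_tsum hf.toFinset fun x _ => (Real.exp_pos _).le)
  rw [Set.ncard_eq_toFinset_card _ hf, ← nsmul_eq_mul, ← Finset.sum_const]
  refine Finset.sum_congr rfl fun x hx => ?_
  have hx' : N x = k := by simpa using hx
  rw [hx']
  congr 1
  ring

theorem nonneg_of_hasNomeExpansion {f : ℍ → ℂ} {a b : ℝ} (h : HasNomeExpansion f 0 a 0 b 0)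
    (hf : ∀ τ : ℍ, τ.re = 0 → a * Real.exp (-Real.pi * τ.im) ≤ (f τ).re) : 0 ≤ b := by
  by_contra! hb
  have h0 : (fun τ : ℍ => Real.exp (-(Real.pi * 5) * τ.im)) =o[atImInfty]
      fun τ : ℍ => Real.exp (-(Real.pi * 3) * τ.im) := by
    have h2 := (isLittleO_one_iff ℝ).mpr (tendsto_exp_im (c := 2) two_pos)
    refine (h2.mul_isBigO (isBigO_refl
      (fun τ : ℍ => Real.exp (-(Real.pi * 3) * τ.im)) atImInfty)).congr (fun τ => ?_) fun τ => ?_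
    · rw [← Real.exp_add]
      congr 1
      ring
    · rw [one_mul]
  have h1 := IsBigO.trans_isLittleO h h0
  have h2 := h1.def (c := -b / 2) (by linarith)
  obtain ⟨A, hA⟩ := (atImInfty_mem _).mp h2
  let τ : ℍ := ⟨max A 1 * Complex.I, by simp⟩
  have him : τ.im = max A 1 := by
    change ((max A 1 : ℝ) * Complex.I : ℂ).im = _
    simp
  have hre : τ.re = 0 := by
    change ((max A 1 : ℝ) * Complex.I : ℂ).re = _
    simp
  have h3 := hA τ (him ▸ le_max_left A 1)
  have hnome : nome τ = (Real.exp (-Real.pi * τ.im) : ℝ) := by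
    have hz : (τ : ℂ) = τ.im * Complex.I := by
      apply Complex.ext <;> simp [hre]
    rw [nome, hz, Complex.ofReal_exp]
    congr 1
    push_cast
    linear_combination (Real.pi * τ.im : ℂ) * Complex.I_mul_I
  have h4 : Real.exp (-(Real.pi * 3) * τ.im) = Real.exp (-Real.pi * τ.im) ^ 3 := by
    rw [← Real.exp_nat_mul]
    congr 1
    push_cast
    ring
  have h5 := hf τ hre
  simp only [Set.mem_ofPred_eq, hnome, h4] at h3
  set r := Real.exp (-Real.pi * τ.im) with hr
  have hr0 : 0 < r := Real.exp_pos _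
  have h6 := (neg_le_abs _).trans ((Complex.abs_re_le_norm _).trans h3)
  have h7 : (f τ - (0 + (a : ℂ) * r + 0 * r ^ 2 + b * r ^ 3 + 0 * r ^ 4)).re =
      (f τ).re - (a * r + b * r ^ 3) := by
    rw [Complex.sub_re, sub_right_inj,
      show (0 + (a : ℂ) * r + 0 * r ^ 2 + b * r ^ 3 + 0 * r ^ 4) = ((a * r + b * r ^ 3 : ℝ) : ℂ) by
        push_cast; ring, Complex.ofReal_re]
  have h8 := (le_abs_self _).trans ((Complex.abs_re_le_norm _).trans h3)
  rw [h7, Real.norm_of_nonneg (pow_pos hr0 3).le] at h8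
  nlinarith [pow_pos hr0 3]

end Coefficients

/-- The modular form of weight `18` in theta constants with the expansion of an extremal theta
series. -/
noncomputable def extremalPoly (α x y : ℂ) : ℂ :=
  x ^ 9 - 9 / 2 * x ^ 7 * y + 117 / 32 * x ^ 5 * y ^ 2 - 15 / 64 * x ^ 3 * y ^ 3
    + α / 16 * x * y ^ 4

theorem hasNomeExpansion_extremalPoly_lattice (α : ℂ) :
    HasNomeExpansion (fun τ => extremalPoly α (thetaThreePow τ) (thetaTwoPow τ * thetaFourPow τ))
      1 0 0 0 (42840 + 4096 * α) := by
  have hA := hasNomeExpansion_thetaThreePow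
  have hA2 := (hA.mul hA).congr_coeff 1 16 112 448 1136 (by norm_num)
  have hA3 := (hA2.mul hA).congr_coeff 1 24 264 1760 7944 (by norm_num)
  have hA5 := (hA3.mul hA2).congr_coeff 1 40 760 9120 77560 (by norm_num)
  have hA7 := (hA5.mul hA2).congr_coeff 1 56 1512 26208 327656 (by norm_num)
  have hA9 := (hA7.mul hA2).congr_coeff 1 72 2520 57120 942552 (by norm_num)
  have hD := (hasNomeExpansion_thetaTwoPow.mul hasNomeExpansion_thetaFourPow).congr_coeff 0 16 (-128) 448 (-1024) (by norm_num)
  have hD2 := (hD.mul hD).congr_coeff 0 0 256 (-4096) 30720 (by norm_num)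
  have hD3 := (hD2.mul hD).congr_coeff 0 0 0 4096 (-98304) (by norm_num)
  have hD4 := (hD2.mul hD2).congr_coeff 0 0 0 0 65536 (by norm_num)
  have h := ((((hA9.add ((hA7.mul hD).const_mul (-9 / 2))).add
    ((hA5.mul hD2).const_mul (117 / 32))).add ((hA3.mul hD3).const_mul (-15 / 64))).add
    ((hA.mul hD4).const_mul (α / 16)))
  convert h using 1
  · funext τ
    rw [extremalPoly]
    ring
  all_goals ring

theorem hasNomeExpansion_extremalPoly_shadow (α : ℂ) :
    HasNomeExpansion
      (fun τ => extremalPoly α (thetaTwoPow τ) (-(thetaThreePow τ * thetaFourPow τ)))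
      0 α 0 (960 - 60 * α) 0 := by
  have hB := hasNomeExpansion_thetaTwoPow
  have hB2 := (hB.mul hB).congr_coeff 0 0 256 0 2048 (by norm_num)
  have hB3 := (hB2.mul hB).congr_coeff 0 0 0 4096 0 (by norm_num)
  have hB5 := (hB3.mul hB2).congr_coeff 0 0 0 0 0 (by norm_num)
  have hB7 := (hB5.mul hB2).congr_coeff 0 0 0 0 0 (by norm_num)
  have hB9 := (hB7.mul hB2).congr_coeff 0 0 0 0 0 (by norm_num)
  have hG := ((hasNomeExpansion_thetaThreePow.mul hasNomeExpansion_thetaFourPow).const_mul (-1)).congr_coeff (-1) 0 16 0 (-112) (by norm_num)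
  have hG2 := (hG.mul hG).congr_coeff 1 0 (-32) 0 480 (by norm_num)
  have hG3 := (hG2.mul hG).congr_coeff (-1) 0 48 0 (-1104) (by norm_num)
  have hG4 := (hG2.mul hG2).congr_coeff 1 0 (-64) 0 1984 (by norm_num)
  have h := ((((hB9.add ((hB7.mul hG).const_mul (-9 / 2))).add
    ((hB5.mul hG2).const_mul (117 / 32))).add ((hB3.mul hG3).const_mul (-15 / 64))).add
    ((hB.mul hG4).const_mul (α / 16)))
  convert h using 1
  · funext τ
    rw [extremalPoly]
    ring
  all_goals ring

theorem mdifferentiable_extremalPoly (α : ℂ) {f g : ℍ → ℂ} (hf : MDiff f) (hg : MDiff g) :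
    MDiff (fun τ => extremalPoly α (f τ) (g τ)) := by
  rw [mdifferentiable_iff] at hf hg ⊢
  change DifferentiableOn ℂ
    (fun z => extremalPoly α ((f ∘ ofComplex) z) ((g ∘ ofComplex) z)) _
  generalize f ∘ ofComplex = u at hf
  generalize g ∘ ofComplex = v at hg
  simp only [extremalPoly]
  fun_prop

end Extremal

section Extremal

open UpperHalfPlane ModularForm ModularGroup MatrixGroups Filter Asymptotics
open scoped Topology Manifold

variable {L : AddSubgroup (Fin 36 → ℝ)}

/-- The norm of a vector in the lattice `L`. -/
noncomputable def latticeNorm (L : AddSubgroup (Fin 36 → ℝ)) (x : L) : ℝ :=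
  ∑ i, (x : Fin 36 → ℝ) i * (x : Fin 36 → ℝ) i

/-- The norm of a vector in the shadow of `L`. -/
noncomputable def shadowNorm (L : AddSubgroup (Fin 36 → ℝ)) (s : shadow (L : Set (Fin 36 → ℝ))) :
    ℝ :=
  ∑ i, (s : Fin 36 → ℝ) i * (s : Fin 36 → ℝ) i

theorem ncard_setOf_latticeNorm (r : ℝ) :
    {x | latticeNorm L x = r}.ncard = {x : Fin 36 → ℝ | x ∈ L ∧ ∑ i, x i * x i = r}.ncard := by
  rw [← Set.ncard_image_of_injective _ Subtype.val_injective]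
  congr 1
  ext x
  simp [latticeNorm, and_comm]

theorem ncard_setOf_shadowNorm (r : ℝ) :
    {s | shadowNorm L s = r}.ncard =
      {s : Fin 36 → ℝ | s ∈ shadow (L : Set (Fin 36 → ℝ)) ∧ ∑ i, s i * s i = r}.ncard := by
  rw [← Set.ncard_image_of_injective _ Subtype.val_injective]
  congr 1
  ext x
  simp [shadowNorm, and_comm]

theorem summable_exp_latticeNorm (hmin : ∀ x ∈ L, x ≠ 0 → (4 : ℝ) ≤ ∑ i, x i * x i) (a : ℝ)
    (ha : 0 < a) : Summable fun x : L => Real.exp (-a * latticeNorm L x) :=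
  (summable_exp_neg_mul_sum four_pos hmin ha 0).congr fun x => by
    simp [latticeNorm, sq]

theorem hasNomeExpansion_thetaSeries_latticeNorm
    (huni : (L : Set (Fin 36 → ℝ)) = dualLattice (L : Set (Fin 36 → ℝ)))
    (hmin : ∀ x ∈ L, x ≠ 0 → (4 : ℝ) ≤ ∑ i, x i * x i) :
    HasNomeExpansion (fun τ => thetaSeries (latticeNorm L) τ) 1 0 0 0
      {x | latticeNorm L x = (4 : ℕ)}.ncard := by
  have hs := summable_exp_latticeNorm hmin
  have hf := finite_setOf_eq_of_summable (hs 1 one_pos) (4 : ℕ)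
  have h0 : latticeNorm L 0 = 0 := by simp [latticeNorm]
  have hn : (0 : L) ∉ hf.toFinset := by
    simp [h0]
  refine (isBigO_thetaSeries_sub_sum (c := 5) (Finset.cons 0 hf.toFinset hn) (fun x hx => ?_)
    hs).congr (fun τ => ?_) fun τ => rfl
  · rw [Finset.mem_cons, not_or] at hx
    rcases sum_mul_self_lattice_cases huni hmin x.2 with h | h | h
    · exact absurd (Subtype.ext h) hx.1
    · exact absurd (hf.mem_toFinset.mpr (by simpa [latticeNorm] using h)) hx.2
    · exact h
  · rw [Finset.sum_cons, sum_cexp_toFinset, h0, Complex.ofReal_zero, mul_zero, Complex.exp_zero]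
    ring

theorem isBigO_thetaSeries_shadowNorm
    (huni : (L : Set (Fin 36 → ℝ)) = dualLattice (L : Set (Fin 36 → ℝ)))
    (hodd : ∃ x ∈ L, ¬ ∃ m : ℤ, ∑ i, x i * x i = ((2 * m : ℤ) : ℝ))
    (hmin : ∀ x ∈ L, x ≠ 0 → (4 : ℝ) ≤ ∑ i, x i * x i) :
    (fun τ : ℍ => thetaSeries (shadowNorm L) τ - {s | shadowNorm L s = (1 : ℕ)}.ncard * nome τ)
      =O[atImInfty] fun τ => Real.exp (-(Real.pi * (5 / 4)) * τ.im) := by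
  have hs : ∀ a : ℝ, 0 < a → Summable fun s => Real.exp (-a * shadowNorm L s) :=
    fun a ha => summable_exp_shadow huni four_pos hmin hodd ha
  have hf := finite_setOf_eq_of_summable (hs 1 one_pos) (1 : ℕ)
  refine (isBigO_thetaSeries_sub_sum hf.toFinset (fun s h => ?_) hs).congr (fun τ => ?_)
    fun τ => rfl
  · rcases sum_mul_self_shadow_cases huni hmin s.2 with h' | h'
    · exact absurd (hf.mem_toFinset.mpr (by simpa [shadowNorm] using h')) h
    · exact h'
  · rw [sum_cexp_toFinset, pow_one]

theorem thetaSeries_eq_extremalPoly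
    (huni : (L : Set (Fin 36 → ℝ)) = dualLattice (L : Set (Fin 36 → ℝ)))
    (hodd : ∃ x ∈ L, ¬ ∃ m : ℤ, ∑ i, x i * x i = ((2 * m : ℤ) : ℝ))
    (hmin : ∀ x ∈ L, x ≠ 0 → (4 : ℝ) ≤ ∑ i, x i * x i) (τ : ℍ) :
    thetaSeries (latticeNorm L) τ = extremalPoly {s | shadowNorm L s = (1 : ℕ)}.ncard
        (thetaThreePow τ) (thetaTwoPow τ * thetaFourPow τ) ∧
      thetaSeries (shadowNorm L) τ = extremalPoly {s | shadowNorm L s = (1 : ℕ)}.ncard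
        (thetaTwoPow τ) (-(thetaThreePow τ * thetaFourPow τ)) := by
  set α : ℂ := (({s | shadowNorm L s = (1 : ℕ)}.ncard : ℕ) : ℂ) with hα
  let F : ℍ → ℂ := fun τ => thetaSeries (latticeNorm L) τ -
    extremalPoly α (thetaThreePow τ) (thetaTwoPow τ * thetaFourPow τ)
  have hTS : ∀ τ : ℍ, F (T • S • τ) = -(τ : ℂ) ^ 18 * (thetaSeries (shadowNorm L) τ -
      extremalPoly α (thetaTwoPow τ) (-(thetaThreePow τ * thetaFourPow τ))) := by
    intro τ
    have hτ := τ.ne_zero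
    have h : thetaSeries (shadowNorm L) τ =
        -((τ : ℂ) ^ 18)⁻¹ * thetaSeries (latticeNorm L) (-1 / τ + 1) :=
      thetaSeries_shadow_eq huni four_pos hmin hodd τ.im_pos
    have h' : thetaSeries (latticeNorm L) (-1 / τ + 1) =
        -(τ : ℂ) ^ 18 * thetaSeries (shadowNorm L) τ := by
      rw [h]
      field_simp
    simp only [F]
    rw [coe_T_smul, coe_S_smul, h', thetaThreePow_T_smul, thetaTwoPow_T_smul, thetaFourPow_T_smul,
      thetaFourPow_S_smul, thetaTwoPow_S_smul, thetaThreePow_S_smul, extremalPoly, extremalPoly]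
    ring
  have hF : ∀ τ, F τ = 0 := by
    refine eq_zero_of_weight_eighteen ?_ (fun τ => ?_) (fun τ => ?_) ?_ ?_
    · exact (mdifferentiable_thetaSeries (fun x => Finset.sum_nonneg fun i _ => mul_self_nonneg _)
        (summable_exp_latticeNorm hmin)).sub (mdifferentiable_extremalPoly α
          mdifferentiable_thetaThreePow
          (mdifferentiable_thetaTwoPow.mul mdifferentiable_thetaFourPow))
    · have hτ := τ.ne_zero
      have h : thetaSeries (latticeNorm L) τ =
          -((τ : ℂ) ^ 18)⁻¹ * thetaSeries (latticeNorm L) (-1 / τ) :=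
        thetaSeries_lattice_eq huni four_pos hmin τ.im_pos
      have h' : thetaSeries (latticeNorm L) (-1 / τ) =
          -(τ : ℂ) ^ 18 * thetaSeries (latticeNorm L) τ := by
        rw [h]
        field_simp
      simp only [F]
      rw [coe_S_smul, h', thetaFourPow_S_smul, thetaTwoPow_S_smul, thetaThreePow_S_smul,
        extremalPoly, extremalPoly]
      ring
    · have h : thetaSeries (latticeNorm L) ((τ : ℂ) + 2) = thetaSeries (latticeNorm L) τ :=
        thetaSeries_lattice_add_two huni τ
      simp only [F]
      rw [coe_T_smul, coe_T_smul, add_assoc, one_add_one_eq_two, h, thetaThreePow_T_smul,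
        thetaFourPow_T_smul, thetaFourPow_T_smul, thetaThreePow_T_smul, thetaTwoPow_T_smul,
        thetaTwoPow_T_smul, neg_neg]
    · have h := ((hasNomeExpansion_thetaSeries_latticeNorm huni hmin).sub
        (hasNomeExpansion_extremalPoly_lattice α)).trans (isBigO_exp_im (b := 4) (by norm_num))
      have h2 := (isBigO_nome_pow 4).const_mul_left
        (({x | latticeNorm L x = (4 : ℕ)}.ncard : ℂ) - (42840 + 4096 * α))
      simp only [Nat.cast_ofNat] at h2
      refine (h.add h2).congr (fun τ => ?_) fun τ => rfl
      simp only [F]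
      ring_nf
    · have h1 := isBigO_thetaSeries_shadowNorm huni hodd hmin
      have h2 := (hasNomeExpansion_extremalPoly_shadow α).trans
        (isBigO_exp_im (b := 5 / 4) (by norm_num))
      have h3 := ((isBigO_nome_pow 3).const_mul_left (960 - 60 * α)).trans
        (isBigO_exp_im (b := 5 / 4) (by norm_num))
      refine ((h2.add h3).sub h1).congr (fun τ => ?_) fun τ => rfl
      have hτ := τ.ne_zero
      rw [hTS, ← hα]
      field_simp
      ring
  refine ⟨sub_eq_zero.mp (hF τ), sub_eq_zero.mp ?_⟩
  have h := hTS τ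
  rw [hF] at h
  exact (mul_eq_zero.mp h.symm).resolve_left (neg_ne_zero.mpr (pow_ne_zero _ τ.ne_zero))

end Extremal

theorem stmt14 (L : AddSubgroup (Fin 36 → ℝ))
    (huni : (L : Set (Fin 36 → ℝ)) = dualLattice (L : Set (Fin 36 → ℝ)))
    (hodd : ∃ x ∈ L, ¬ ∃ m : ℤ, ∑ i, x i * x i = ((2 * m : ℤ) : ℝ))
    (hmin : ∀ x ∈ L, x ≠ 0 → (4 : ℝ) ≤ ∑ i, x i * x i)
    (hex : ∃ x ∈ L, ∑ i, x i * x i = (4 : ℝ)) :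
    {s : Fin 36 → ℝ | s ∈ shadow (L : Set (Fin 36 → ℝ)) ∧
        ∑ i, s i * s i = (1 : ℝ)}.ncard ≤ 16 ∧
      {x : Fin 36 → ℝ | x ∈ L ∧ ∑ i, x i * x i = (4 : ℝ)}.ncard
        = 42840 + 4096 * {s : Fin 36 → ℝ | s ∈ shadow (L : Set (Fin 36 → ℝ)) ∧
            ∑ i, s i * s i = (1 : ℝ)}.ncard := by
  have heq := thetaSeries_eq_extremalPoly huni hodd hmin
  rw [← ncard_setOf_latticeNorm, ← ncard_setOf_shadowNorm, ← Nat.cast_one (R := ℝ),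
    show (4 : ℝ) = (4 : ℕ) from (Nat.cast_ofNat (R := ℝ) (n := 4)).symm]
  set α := {s | shadowNorm L s = (1 : ℕ)}.ncard with hα
  constructor
  · have h : HasNomeExpansion (fun τ => thetaSeries (shadowNorm L) τ) 0 (α : ℝ) 0
        ((960 - 60 * α : ℝ) : ℂ) 0 :=
      ((hasNomeExpansion_extremalPoly_shadow α).congr_left fun τ => (heq τ).2.symm).congr_coeff
        _ _ _ _ _ (by simp)
    have h' := nonneg_of_hasNomeExpansion h fun τ hτ => by
      have := ncard_mul_exp_le_re_thetaSeries (N := shadowNorm L)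
        (fun a ha => summable_exp_shadow huni four_pos hmin hodd ha) 1 hτ
      rw [Nat.cast_one, mul_one] at this
      simpa [α] using this
    have : (α : ℝ) ≤ 16 := by linarith
    exact_mod_cast this
  · have h := (((hasNomeExpansion_thetaSeries_latticeNorm huni hmin).sub
      (hasNomeExpansion_extremalPoly_lattice α)).congr_left
        fun τ => sub_eq_zero.mpr (heq τ).1).congr_coeff 0 0 0 0 _
        ⟨sub_self _, sub_self _, sub_self _, sub_self _, rfl⟩
    have h' := sub_eq_zero.mp h.eq_zero_of_zero
    exact_mod_cast h'
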